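/- arXiv:2502.01082 — 2 statements merged into one kernel-verified Lean document; each statement's English description precedes it below -/
import Mathlib

section
/- Suppose the structure on ℝ is d-minimal and let p be a positive integer. Let U ⊆ ℝⁿ be a definable open set and f : U → ℝ a definable function. Then there exists a definable subset D of U, closed in U and with empty interior, such that the restriction of f to U ∖ D is of class C^p. -/
open FirstOrder Set Filter Topology
open scoped Classical

noncomputable section

namespace DMinPaper

variable (L : FirstOrder.Language) [L.Structure ℝ]

/-- A subset of `ℝ^α` is definable (with parameters from `ℝ`) in the structure `L`. -/
def IsDef {α : Type} (s : Set (α → ℝ)) : Prop :=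
  (Set.univ : Set ℝ).Definable L s

/-- Definability of an `ℝ`-valued function on a subset `M ⊆ ℝ^α`, via its graph. -/
def IsDefFunOn {α : Type} (M : Set (α → ℝ)) (f : (α → ℝ) → ℝ) : Prop :=
  IsDef L {z : (α ⊕ Unit) → ℝ |
    (fun i => z (Sum.inl i)) ∈ M ∧ z (Sum.inr ()) = f (fun i => z (Sum.inl i))}

/-- Definability of a map `M → ℝ^β` on a subset `M ⊆ ℝ^α`, via its graph. -/
def IsDefMapOn {α β : Type} (M : Set (α → ℝ)) (f : (α → ℝ) → (β → ℝ)) : Prop :=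
  IsDef L {z : (α ⊕ β) → ℝ |
    (fun i => z (Sum.inl i)) ∈ M ∧ (fun j => z (Sum.inr j)) = f (fun i => z (Sum.inl i))}

/-- Definability of an `ℝ`-valued function on a subset of a product `ℝ^α × ℝ^β`. -/
def IsDefFun2On {α β : Type} (S : Set ((α → ℝ) × (β → ℝ)))
    (f : (α → ℝ) × (β → ℝ) → ℝ) : Prop :=
  IsDef L {z : ((α ⊕ β) ⊕ Unit) → ℝ |
    ((fun i => z (Sum.inl (Sum.inl i)), fun j => z (Sum.inl (Sum.inr j))) ∈ S) ∧
    z (Sum.inr ()) = f (fun i => z (Sum.inl (Sum.inl i)), fun j => z (Sum.inl (Sum.inr j)))}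

/-- Definability of a map into `ℝ^γ` on a subset of a product `ℝ^α × ℝ^β`. -/
def IsDefMap2On {α β γ : Type} (S : Set ((α → ℝ) × (β → ℝ)))
    (f : (α → ℝ) × (β → ℝ) → (γ → ℝ)) : Prop :=
  IsDef L {z : ((α ⊕ β) ⊕ γ) → ℝ |
    ((fun i => z (Sum.inl (Sum.inl i)), fun j => z (Sum.inl (Sum.inr j))) ∈ S) ∧
    (fun l => z (Sum.inr l)) = f (fun i => z (Sum.inl (Sum.inl i)), fun j => z (Sum.inl (Sum.inr j)))}

/-- Definability of a function `ℝ → ℝ`, via its graph. -/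
def IsDefFunR (f : ℝ → ℝ) : Prop :=
  IsDef L {z : Fin 2 → ℝ | z 1 = f (z 0)}

/-- The structure expands the ordered field of real numbers: the order, addition and
multiplication are definable. -/
def ExpandsOrderedField : Prop :=
  IsDef L {x : Fin 2 → ℝ | x 0 < x 1} ∧
  IsDef L {x : Fin 3 → ℝ | x 2 = x 0 + x 1} ∧
  IsDef L {x : Fin 3 → ℝ | x 2 = x 0 * x 1}

/-- A discrete subset of `ℝ`. -/
def IsDiscreteSet (D : Set ℝ) : Prop :=
  ∀ x ∈ D, ∃ U : Set ℝ, IsOpen U ∧ U ∩ D = {x}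

/-- d-minimality: the structure expands the ordered field of reals, and in every definable
family of subsets of `ℝ` each fiber is the union of an open set and `N` discrete sets, where
`N` does not depend on the parameter. -/
def DMinimal : Prop :=
  ExpandsOrderedField L ∧
  ∀ (k : ℕ) (S : Set ((Fin k ⊕ Unit) → ℝ)), IsDef L S →
    ∃ N : ℕ, ∀ a : Fin k → ℝ,
      ∃ (U : Set ℝ) (D : Fin N → Set ℝ),
        IsOpen U ∧ (∀ i, IsDiscreteSet (D i)) ∧
        {t : ℝ | Sum.elim a (fun _ => t) ∈ S} = U ∪ ⋃ i, D i

variable {E F : Type} [NormedAddCommGroup E] [NormedSpace ℝ E]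
  [NormedAddCommGroup F] [NormedSpace ℝ F]

/-- `f` is of class `C^p` on `M` (as a function on the submanifold `M`): near each point of `M`
it coincides on `M` with a `C^p` function defined on an ambient open set. -/
def CpOn (p : ℕ) (f : E → F) (M : Set E) : Prop :=
  ∀ x ∈ M, ∃ (U : Set E) (g : E → F),
    IsOpen U ∧ x ∈ U ∧ ContDiffOn ℝ p g U ∧ Set.EqOn f g (M ∩ U)

/-- The tangent vectors to `M` at `x`: velocities of differentiable curves through `x`
staying in `M`. -/
def TangentVecs (M : Set E) (x : E) : Set E :=
  {v | ∃ γ : ℝ → E, γ 0 = x ∧ (∀ᶠ t in 𝓝 (0:ℝ), γ t ∈ M) ∧ HasDerivAt γ v 0}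

/-- The differential of `f : M → N` at `x` is surjective onto the tangent space of `N`
at `f x`. -/
def SubmersionAtOn (f : E → F) (M : Set E) (N : Set F) (x : E) : Prop :=
  ∀ w ∈ TangentVecs N (f x), ∃ (γ : ℝ → E) (v : E),
    γ 0 = x ∧ (∀ᶠ t in 𝓝 (0:ℝ), γ t ∈ M) ∧ HasDerivAt γ v 0 ∧
    HasDerivAt (fun t => f (γ t)) w 0

/-- `x` is a critical point of `f : M → ℝ`: the differential of `f` at `x` vanishes on all
tangent vectors of `M` at `x`. -/
def IsCritPtOn (f : E → ℝ) (M : Set E) (x : E) : Prop :=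
  x ∈ M ∧ ∀ (γ : ℝ → E) (v : E), γ 0 = x → (∀ᶠ t in 𝓝 (0:ℝ), γ t ∈ M) →
    HasDerivAt γ v 0 → HasDerivAt (fun t => f (γ t)) 0 0

/-- `x` is a nondegenerate critical point of `f : M → ℝ` on the `d`-dimensional submanifold
`M`: in a local `C²` parametrization `ψ` of `M` at `x`, the Hessian of `f ∘ ψ` is a
nondegenerate bilinear form. -/
def IsNondegCritPtOn (f : E → ℝ) (M : Set E) (d : ℕ) (x : E) : Prop :=
  IsCritPtOn f M x ∧
  ∃ (W : Set (Fin d → ℝ)) (ψ : (Fin d → ℝ) → E) (w0 : Fin d → ℝ),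
    IsOpen W ∧ w0 ∈ W ∧ ContDiffOn ℝ 2 ψ W ∧ ψ w0 = x ∧ Set.MapsTo ψ W M ∧
    Function.Injective (fun u => fderiv ℝ ψ w0 u) ∧
    ∀ v : Fin d → ℝ, v ≠ 0 → ∃ w : Fin d → ℝ,
      iteratedFDeriv ℝ 2 (fun z => f (ψ z)) w0 ![v, w] ≠ 0

/-- `f` is a Morse function on the `d`-dimensional submanifold `M`: all critical points are
nondegenerate and distinct critical points have distinct critical values. -/
def IsMorseOn (f : E → ℝ) (M : Set E) (d : ℕ) : Prop :=
  (∀ x, IsCritPtOn f M x → IsNondegCritPtOn f M d x) ∧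
  ∀ x y, IsCritPtOn f M x → IsCritPtOn f M y → x ≠ y → f x ≠ f y

/-- `M ⊆ ℝⁿ` is a definable `C^p` submanifold of dimension `d`: `M` is definable and every
point of `M` has a definable `C^p` chart of `ℝⁿ` flattening `M` onto `ℝ^d × {0}`. -/
def IsDpSubmanifold (p : ℕ) {n : ℕ} (d : ℕ) (M : Set (Fin n → ℝ)) : Prop :=
  IsDef L M ∧ d ≤ n ∧
  ∀ x ∈ M, ∃ (U V : Set (Fin n → ℝ)) (φ ψ : (Fin n → ℝ) → (Fin n → ℝ)),
    IsOpen U ∧ x ∈ U ∧ IsOpen V ∧ (0 : Fin n → ℝ) ∈ V ∧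
    IsDef L U ∧ IsDef L V ∧ IsDefMapOn L U φ ∧ IsDefMapOn L V ψ ∧
    ContDiffOn ℝ p φ U ∧ ContDiffOn ℝ p ψ V ∧
    Set.MapsTo φ U V ∧ Set.MapsTo ψ V U ∧
    (∀ y ∈ U, ψ (φ y) = y) ∧ (∀ y ∈ V, φ (ψ y) = y) ∧
    φ x = 0 ∧ φ '' (M ∩ U) = V ∩ {y | ∀ i : Fin n, d ≤ (i : ℕ) → y i = 0}

/-- The definable set `X ⊆ ℝⁿ` has dimension at least `d`: some projection of `X` onto `d`
of the coordinates has nonempty interior. -/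
def hasDimGE {n : ℕ} (X : Set (Fin n → ℝ)) (d : ℕ) : Prop :=
  ∃ ι : Fin d → Fin n, StrictMono ι ∧ (interior ((fun x => fun i => x (ι i)) '' X)).Nonempty

/-- The dimension of `X ⊆ ℝⁿ`: the largest `d` such that some coordinate projection of `X`
onto `ℝ^d` has nonempty interior; `⊥` (i.e. `-∞`) for the empty set. -/
noncomputable def dimDef {n : ℕ} (X : Set (Fin n → ℝ)) : WithBot ℕ :=
  if X.Nonempty then ((sSup {d : ℕ | hasDimGE X d} : ℕ) : WithBot ℕ) else ⊥

/-- The coordinate projection `ℝⁿ → ℝ^d` determined by `ι`. -/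
def projc {n d : ℕ} (ι : Fin d → Fin n) (x : Fin n → ℝ) : Fin d → ℝ := fun i => x (ι i)

/-- An open box in `ℝⁿ`: a product of `n` nonempty open intervals. -/
def IsOpenBox {n : ℕ} (U : Set (Fin n → ℝ)) : Prop :=
  ∃ a b : Fin n → ℝ, (∀ i, a i < b i) ∧ U = Set.univ.pi fun i => Set.Ioo (a i) (b i)

/-- `M` is locally, at `x`, the image of a definable `C^p` section `τ` of the coordinate
projection `projc ι`. -/
def MultiGraphPtAt (p : ℕ) {n d : ℕ} (ι : Fin d → Fin n) (M : Set (Fin n → ℝ))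
    (x : Fin n → ℝ) : Prop :=
  ∃ U : Set (Fin n → ℝ), IsOpenBox U ∧ x ∈ U ∧
    ∃ τ : (Fin d → ℝ) → (Fin n → ℝ),
      IsDefMapOn L (projc ι '' U) τ ∧ ContDiffOn ℝ p τ (projc ι '' U) ∧
      M ∩ U = τ '' (projc ι '' U) ∧ ∀ z ∈ projc ι '' U, projc ι (τ z) = z

/-- A `D^p` multi-valued graph with respect to the coordinate projection `projc ι`. -/
def IsMultiGraph (p : ℕ) {n d : ℕ} (ι : Fin d → Fin n) (M : Set (Fin n → ℝ)) : Prop :=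
  IsDpSubmanifold L p d M ∧ ∀ x ∈ M, MultiGraphPtAt L p ι M x

/-- The gradient vector `(∂g/∂x₁, …, ∂g/∂x_d)` of `g : ℝ^d → ℝ` at `z`. -/
noncomputable def gradVec {d : ℕ} (g : (Fin d → ℝ) → ℝ) (z : Fin d → ℝ) : Fin d → ℝ :=
  fun i => fderiv ℝ g z (Pi.single i 1)

/-- The Hessian matrix `(∂²g/∂x_i∂x_j)` of `g : ℝ^d → ℝ` at `z`. -/
noncomputable def hessMat {d : ℕ} (g : (Fin d → ℝ) → ℝ) (z : Fin d → ℝ) :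
    Matrix (Fin d) (Fin d) ℝ :=
  Matrix.of fun i j => fderiv ℝ (fun w => fderiv ℝ g w (Pi.single j 1)) z (Pi.single i 1)

/-- The derivative of `f : M → ℝ` at `x` along the vector field `D`: the common value of
`d_x g (D x)` over all local `C¹` extensions `g` of `f` (and `0` if there is no such common
value). -/
noncomputable def vderiv (M : Set E) (D : E → E) (f : E → ℝ) (x : E) : ℝ :=
  if h : ∃ w : ℝ, ∀ (U : Set E) (g : E → ℝ), IsOpen U → x ∈ U → ContDiffOn ℝ 1 g U →
      Set.EqOn f g (M ∩ U) → fderiv ℝ g x (D x) = w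
  then h.choose else 0

/-- Iterated derivative `D_{α₁} ⋯ D_{α_m} f` of `f : M → ℝ` along a finite family of vector
fields, indexed by a list `α`. -/
noncomputable def vderivIter {k : ℕ} (M : Set E) (D : Fin k → E → E) :
    List (Fin k) → (E → ℝ) → E → ℝ
  | [], f => f
  | i :: l, f => vderiv M (D i) (vderivIter M D l f)

section Framework

variable {L}
variable {α β ι : Type}

/-- definable predicate -/
def DP (L : FirstOrder.Language) [L.Structure ℝ] {α : Type} (P : (α → ℝ) → Prop) : Prop :=
  IsDef L {x | P x}

/-- definable total function -/
def DF (L : FirstOrder.Language) [L.Structure ℝ] {α : Type} (f : (α → ℝ) → ℝ) : Prop :=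
  (Set.univ : Set ℝ).DefinableFun L f

theorem dp_congr {P Q : (α → ℝ) → Prop} (h : DP L P) (hPQ : ∀ x, P x ↔ Q x) : DP L Q := by
  have : P = Q := by
    funext x
    exact propext (hPQ x)
  rwa [← this]

theorem dp_and {P Q : (α → ℝ) → Prop} (hP : DP L P) (hQ : DP L Q) :
    DP L (fun x => P x ∧ Q x) := Set.Definable.inter hP hQ

theorem dp_or {P Q : (α → ℝ) → Prop} (hP : DP L P) (hQ : DP L Q) :
    DP L (fun x => P x ∨ Q x) := Set.Definable.union hP hQ

theorem dp_not {P : (α → ℝ) → Prop} (hP : DP L P) :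
    DP L (fun x => ¬ P x) := Set.Definable.compl hP

theorem dp_imp {P Q : (α → ℝ) → Prop} (hP : DP L P) (hQ : DP L Q) :
    DP L (fun x => P x → Q x) :=
  dp_congr (dp_or (dp_not hP) hQ) (fun x => by tauto)

theorem dp_const (p : Prop) : DP L (fun _ : α → ℝ => p) := by
  by_cases hp : p
  · exact dp_congr (P := fun _ => True) (Set.definable_univ) (fun x => by simp [hp])
  · exact dp_congr (P := fun _ => False) (Set.definable_empty) (fun x => by simp [hp])

theorem dp_fin [Finite ι] {P : ι → (α → ℝ) → Prop} (hP : ∀ i, DP L (P i)) :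
    DP L (fun x => ∀ i, P i x) := by
  have := Set.definable_iInter_of_finite (f := fun i => {x | P i x}) hP
  unfold DP IsDef
  convert this using 1
  ext x
  simp

theorem dp_exT [Finite β] {P : (α → ℝ) → (β → ℝ) → Prop}
    (h : DP L (fun z : α ⊕ β → ℝ => P (fun a => z (Sum.inl a)) (fun b => z (Sum.inr b)))) :
    DP L (fun x => ∃ y, P x y) :=
  Set.Definable.exists_of_finite h

theorem dp_allT [Finite β] {P : (α → ℝ) → (β → ℝ) → Prop}
    (h : DP L (fun z : α ⊕ β → ℝ => P (fun a => z (Sum.inl a)) (fun b => z (Sum.inr b)))) :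
    DP L (fun x => ∀ y, P x y) :=
  Set.Definable.forall_of_finite h

theorem dp_exR {P : (α → ℝ) → ℝ → Prop}
    (h : DP L (fun z : α ⊕ Unit → ℝ => P (fun a => z (Sum.inl a)) (z (Sum.inr ())))) :
    DP L (fun x => ∃ t, P x t) :=
  dp_congr (dp_exT (P := fun x (y : Unit → ℝ) => P x (y ())) h) (fun x =>
    ⟨fun ⟨y, hy⟩ => ⟨y (), hy⟩, fun ⟨t, ht⟩ => ⟨fun _ => t, ht⟩⟩)

theorem dp_allR {P : (α → ℝ) → ℝ → Prop}
    (h : DP L (fun z : α ⊕ Unit → ℝ => P (fun a => z (Sum.inl a)) (z (Sum.inr ())))) :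
    DP L (fun x => ∀ t, P x t) :=
  dp_congr (dp_allT (P := fun x (y : Unit → ℝ) => P x (y ())) h) (fun x =>
    ⟨fun hy t => hy (fun _ => t), fun ht y => ht (y ())⟩)

theorem dp_comp [Finite β] {P : (β → ℝ) → Prop} (hP : DP L P) {g : β → (α → ℝ) → ℝ}
    (hg : ∀ b, DF L (g b)) : DP L (fun x => P (fun b => g b x)) :=
  Set.Definable.preimage_map (F := fun x b => g b x) hg hP

theorem df_var (i : α) : DF L (fun x : α → ℝ => x i) := Set.DefinableFun.proj L

theorem df_const (c : ℝ) : DF L (fun _ : α → ℝ => c) :=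
  L.definableFun_const α (Set.mem_univ c)

theorem df_comp [Finite β] {f : (β → ℝ) → ℝ} (hf : DF L f) {g : β → (α → ℝ) → ℝ}
    (hg : ∀ b, DF L (g b)) : DF L (fun x => f (fun b => g b x)) :=
  Set.DefinableFun.comp (g := fun x b => g b x) hg hf

theorem dp_eq {f g : (α → ℝ) → ℝ} (hf : DF L f) (hg : DF L g) : DP L (fun x => f x = g x) :=
  hf.ofPred_eq hg

theorem df_of_graph [Finite α] {f : (α → ℝ) → ℝ}
    (h : DP L (fun z : Option α → ℝ => f (fun a => z (some a)) = z none)) : DF L f := h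

theorem df_ite {P : (α → ℝ) → Prop} {f g : (α → ℝ) → ℝ} (hP : DP L P) (hf : DF L f)
    (hg : DF L g) : DF L (fun x => if P x then f x else g x) :=
  Set.DefinableFun.ite hP hf hg

theorem dp_lt (h : ExpandsOrderedField L) {f g : (α → ℝ) → ℝ} (hf : DF L f) (hg : DF L g) :
    DP L (fun x => f x < g x) :=
  dp_comp (P := fun x : Fin 2 → ℝ => x 0 < x 1) h.1 (g := ![f, g])
    (by intro b; fin_cases b; exacts [hf, hg])

theorem dp_le (h : ExpandsOrderedField L) {f g : (α → ℝ) → ℝ} (hf : DF L f) (hg : DF L g) :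
    DP L (fun x => f x ≤ g x) :=
  dp_congr (dp_not (dp_lt h hg hf)) (fun x => not_lt)

theorem df_add [Finite α] (h : ExpandsOrderedField L) {f g : (α → ℝ) → ℝ} (hf : DF L f)
    (hg : DF L g) : DF L (fun x => f x + g x) := by
  apply df_of_graph
  refine dp_congr (dp_comp (P := fun x : Fin 3 → ℝ => x 2 = x 0 + x 1) h.2.1
    (g := ![fun z : Option α → ℝ => f (fun a => z (some a)),
      fun z => g (fun a => z (some a)), fun z => z none])
    (by
      intro b
      fin_cases b
      exacts [df_comp hf fun b => df_var _, df_comp hg fun b => df_var _, df_var _])) ?_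
  intro x
  exact eq_comm

theorem df_mul [Finite α] (h : ExpandsOrderedField L) {f g : (α → ℝ) → ℝ} (hf : DF L f)
    (hg : DF L g) : DF L (fun x => f x * g x) := by
  apply df_of_graph
  refine dp_congr (dp_comp (P := fun x : Fin 3 → ℝ => x 2 = x 0 * x 1) h.2.2
    (g := ![fun z : Option α → ℝ => f (fun a => z (some a)),
      fun z => g (fun a => z (some a)), fun z => z none])
    (by
      intro b
      fin_cases b
      exacts [df_comp hf fun b => df_var _, df_comp hg fun b => df_var _, df_var _])) ?_
  intro x
  exact eq_comm

theorem df_sub [Finite α] (h : ExpandsOrderedField L) {f g : (α → ℝ) → ℝ} (hf : DF L f)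
    (hg : DF L g) : DF L (fun x => f x - g x) := by
  have := df_add h hf (df_mul h (df_const (-1)) hg)
  convert this using 2
  ring

theorem df_abs [Finite α] (h : ExpandsOrderedField L) {f : (α → ℝ) → ℝ} (hf : DF L f) :
    DF L (fun x => |f x|) := by
  have := df_ite (dp_le h (df_const 0) hf) hf (df_sub h (df_const 0) hf)
  convert this using 2 with x
  split_ifs with h0
  · exact abs_of_nonneg h0
  · rw [abs_of_neg (not_le.1 h0)]; ring

theorem df_update [Finite α] [DecidableEq α] (i : α) {β : Type} {g : (β → ℝ) → ℝ} {x : α → (β → ℝ) → ℝ}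
    (hg : DF L g) (hx : ∀ a, DF L (x a)) (a : α) :
    DF L (fun z => Function.update (fun a => x a z) i (g z) a) := by
  by_cases hai : a = i
  · subst hai
    simpa using hg
  · simpa [hai] using hx a

end Framework

section Dichotomy

variable {L}

theorem discrete_avoid {D : Set ℝ} (hD : IsDiscreteSet D) {a b : ℝ} (hab : a < b) :
    ∃ c d, c < d ∧ Ioo c d ⊆ Ioo a b ∧ Ioo c d ∩ D = ∅ := by
  by_cases h : (Ioo a b ∩ D).Nonempty
  · obtain ⟨x, hx, hxD⟩ := h
    obtain ⟨U, hU, hUx⟩ := hD x hxD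
    have hxU : x ∈ U := by
      have : x ∈ U ∩ D := by rw [hUx]; rfl
      exact this.1
    have hn : U ∩ Ioo a b ∈ 𝓝 x := (hU.inter isOpen_Ioo).mem_nhds ⟨hxU, hx⟩
    obtain ⟨ε, hε, hb⟩ := Metric.mem_nhds_iff.1 hn
    have key : ∀ y ∈ Ioo x (x + ε), y ∈ U ∩ Ioo a b := by
      intro y hy
      apply hb
      rw [Metric.mem_ball, Real.dist_eq, abs_lt]
      constructor <;> linarith [hy.1, hy.2]
    refine ⟨x, x + ε, by linarith, fun y hy => (key y hy).2, ?_⟩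
    apply Set.eq_empty_of_forall_notMem
    rintro y ⟨hy, hyD⟩
    have : y ∈ U ∩ D := ⟨(key y hy).1, hyD⟩
    rw [hUx] at this
    have h1 : y = x := this
    linarith [hy.1]
  · exact ⟨a, b, hab, le_rfl, Set.not_nonempty_iff_eq_empty.1 h⟩

theorem discretes_avoid : ∀ (N : ℕ) (D : Fin N → Set ℝ), (∀ i, IsDiscreteSet (D i)) →
    ∀ a b : ℝ, a < b → ∃ c d, c < d ∧ Ioo c d ⊆ Ioo a b ∧ ∀ i, Ioo c d ∩ D i = ∅ := by
  intro N
  induction N with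
  | zero => exact fun D _ a b hab => ⟨a, b, hab, le_rfl, fun i => i.elim0⟩
  | succ N ih =>
    intro D hD a b hab
    obtain ⟨c, d, hcd, hs, h0⟩ := discrete_avoid (hD 0) hab
    obtain ⟨c', d', hcd', hs', h1⟩ := ih (fun i => D i.succ) (fun i => hD _) c d hcd
    refine ⟨c', d', hcd', hs'.trans hs, fun i => ?_⟩
    refine Fin.cases ?_ h1 i
    exact Set.subset_eq_empty (Set.inter_subset_inter_left _ hs') h0

theorem dich_fiber (hL : DMinimal L) {k : ℕ} {P : (Fin k ⊕ Unit → ℝ) → Prop} (hP : DP L P)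
    (x : Fin k → ℝ) {a b : ℝ} (hab : a < b) :
    (∃ c d, c < d ∧ Ioo c d ⊆ Ioo a b ∧ ∀ t ∈ Ioo c d, P (Sum.elim x (fun _ => t))) ∨
    (∃ c d, c < d ∧ Ioo c d ⊆ Ioo a b ∧ ∀ t ∈ Ioo c d, ¬ P (Sum.elim x (fun _ => t))) := by
  obtain ⟨N, hN⟩ := hL.2 k _ hP
  obtain ⟨U, D, hU, hD, hE⟩ := hN x
  by_cases h : (Ioo a b ∩ U).Nonempty
  · left
    obtain ⟨y, hy⟩ := h
    obtain ⟨ε, hε, hb⟩ := Metric.mem_nhds_iff.1 ((isOpen_Ioo.inter hU).mem_nhds hy)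
    rw [Real.ball_eq_Ioo] at hb
    refine ⟨y - ε, y + ε, by linarith, fun t ht => (hb ht).1, fun t ht => ?_⟩
    have : t ∈ U ∪ ⋃ i, D i := Or.inl (hb ht).2
    rw [← hE] at this
    exact this
  · right
    obtain ⟨c, d, hcd, hs, h0⟩ := discretes_avoid N D hD a b hab
    refine ⟨c, d, hcd, hs, fun t ht hPt => ?_⟩
    have : t ∈ {t : ℝ | Sum.elim x (fun _ => t) ∈ {x | P x}} := hPt
    rw [hE] at this
    rcases this with h1 | h1
    · exact h ⟨t, hs ht, h1⟩
    · obtain ⟨i, hi⟩ := Set.mem_iUnion.1 h1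
      have : t ∈ Ioo c d ∩ D i := ⟨ht, hi⟩
      rw [h0 i] at this
      exact this

theorem rat_sub {a b : ℝ} (hab : a < b) : ∃ q r : ℚ, (q : ℝ) < r ∧ Ioo (q : ℝ) r ⊆ Ioo a b := by
  obtain ⟨q, h1, h2⟩ := exists_rat_btwn hab
  obtain ⟨r, h3, h4⟩ := exists_rat_btwn h2
  exact ⟨q, r, h3, Ioo_subset_Ioo h1.le h4.le⟩

theorem dp_ball (h : ExpandsOrderedField L) {n : ℕ} (c : Fin n → ℝ) (ε : ℝ) :
    DP L (fun x : Fin n → ℝ => ∀ i, |x i - c i| < ε) :=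
  dp_fin fun i => dp_lt h (df_abs h (df_sub h (df_var i) (df_const _))) (df_const _)

theorem dich (hL : DMinimal L) : ∀ (n : ℕ) (P : (Fin n → ℝ) → Prop), DP L P →
    (interior (closure {x | P x})).Nonempty → (interior {x | P x}).Nonempty := by
  intro n
  induction n with
  | zero =>
    intro P _ hne
    obtain ⟨x, hx⟩ := hne
    have h1 : (closure {x | P x}).Nonempty := ⟨x, interior_subset hx⟩
    obtain ⟨y, hy⟩ := closure_nonempty_iff.1 h1
    have : {x | P x} = Set.univ := by
      ext z
      have : z = y := Subsingleton.elim _ _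
      subst this
      simpa using hy
    rw [this, interior_univ]
    exact ⟨x, trivial⟩
  | succ n ih =>
    intro P hP hne
    obtain ⟨x₀, hx₀⟩ := hne
    obtain ⟨ε, hε, hb⟩ := Metric.mem_nhds_iff.1 (isOpen_interior.mem_nhds hx₀)
    have hO : ∀ (W : Set (Fin n → ℝ)) (a b : ℝ), IsOpen W →
        IsOpen {y : Fin (n + 1) → ℝ | y 0 ∈ Ioo a b ∧ (fun i : Fin n => y i.succ) ∈ W} := by
      intro W a b hW
      exact (isOpen_Ioo.preimage (continuous_apply 0)).inter
        (hW.preimage (continuous_pi fun i => continuous_apply _))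
    have hcons : ∀ y : Fin (n + 1) → ℝ,
        (Fin.cons (y 0) (fun i : Fin n => y i.succ) : Fin (n + 1) → ℝ) = y :=
      fun y => Fin.cons_self_tail y
    set c : Fin n → ℝ := fun i => x₀ i.succ with hc
    have hcl : ∀ t ∈ Ioo (x₀ 0 - ε) (x₀ 0 + ε), ∀ x : Fin n → ℝ, (∀ i, |x i - c i| < ε) →
        (Fin.cons t x : Fin (n + 1) → ℝ) ∈ closure {x | P x} := by
      intro t ht x hx
      apply interior_subset
      apply hb
      rw [Metric.mem_ball, dist_pi_lt_iff hε]
      intro i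
      refine Fin.cases ?_ (fun j => ?_) i
      · simp only [Fin.cons_zero, Real.dist_eq, abs_lt]
        constructor <;> linarith [ht.1, ht.2]
      · simpa [Real.dist_eq] using hx j
    -- the family
    let B : ℚ × ℚ → (Fin n → ℝ) → Prop := fun qr x =>
      ((qr.1 : ℝ) < qr.2) ∧ ∀ t : ℝ, ((qr.1 : ℝ) < t ∧ t < qr.2) → P (Fin.cons t x)
    let C : ℚ × ℚ → (Fin n → ℝ) → Prop := fun qr x =>
      (((qr.1 : ℝ) < qr.2 ∧ Ioo (qr.1 : ℝ) qr.2 ⊆ Ioo (x₀ 0 - ε) (x₀ 0 + ε)) ∧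
        ∀ i, |x i - c i| < ε) ∧
        ∀ t : ℝ, ((qr.1 : ℝ) < t ∧ t < qr.2) → ¬ P (Fin.cons t x)
    have hcd : ∀ i : Fin (n + 1), DF L (fun z : Fin n ⊕ Unit → ℝ =>
        (Fin.cons (z (Sum.inr ())) (fun a => z (Sum.inl a)) : Fin (n + 1) → ℝ) i) := by
      intro i
      refine Fin.cases ?_ (fun j => ?_) i
      · simpa using df_var (L := L) _
      · simpa using df_var (L := L) _
    have hPc : DP L (fun z : Fin n ⊕ Unit → ℝ =>
        P (Fin.cons (z (Sum.inr ())) (fun a => z (Sum.inl a)))) := dp_comp hP hcd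
    have hIc : ∀ qr : ℚ × ℚ, DP L (fun z : Fin n ⊕ Unit → ℝ =>
        ((qr.1 : ℝ) < z (Sum.inr ()) ∧ z (Sum.inr ()) < qr.2)) := fun qr =>
      dp_and (dp_lt hL.1 (df_const _) (df_var _)) (dp_lt hL.1 (df_var _) (df_const _))
    have hB : ∀ qr, DP L (B qr) := fun qr =>
      dp_and (dp_const _) (dp_allR (dp_imp (hIc qr) hPc))
    have hC : ∀ qr, DP L (C qr) := fun qr =>
      dp_and (dp_and (dp_const _) (dp_ball hL.1 c ε)) (dp_allR (dp_imp (hIc qr) (dp_not hPc)))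
    have hcov : ∀ x ∈ Metric.ball c ε, (∃ qr, B qr x) ∨ ∃ qr, C qr x := by
      intro x hx
      rw [Metric.mem_ball, dist_pi_lt_iff hε] at hx
      rcases dich_fiber hL hPc x (show x₀ 0 - ε < x₀ 0 + ε by linarith) with
        ⟨a, b, hab, hs, h⟩ | ⟨a, b, hab, hs, h⟩
      · obtain ⟨q, r, hqr, hs'⟩ := rat_sub hab
        exact Or.inl ⟨(q, r), hqr, fun t ht => h t (hs' ht)⟩
      · obtain ⟨q, r, hqr, hs'⟩ := rat_sub hab
        exact Or.inr ⟨(q, r), ⟨⟨hqr, hs'.trans hs⟩, hx⟩, fun t ht => h t (hs' ht)⟩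
    have hBaire : (∃ qr, (interior (closure {x | B qr x})).Nonempty) ∨
        ∃ qr, (interior (closure {x | C qr x})).Nonempty := by
      by_contra hcon
      push Not at hcon
      obtain ⟨h1, h2⟩ := hcon
      have d1 : Dense (⋂ qr, (closure {x | B qr x})ᶜ) :=
        dense_iInter_of_isOpen (fun qr => isClosed_closure.isOpen_compl)
          (fun qr => interior_eq_empty_iff_dense_compl.1 (h1 qr))
      have d2 : Dense (⋂ qr, ((closure {x | B qr x})ᶜ ∩ (closure {x | C qr x})ᶜ)) :=
        dense_iInter_of_isOpen
          (fun qr => isClosed_closure.isOpen_compl.inter isClosed_closure.isOpen_compl)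
          (fun qr => (interior_eq_empty_iff_dense_compl.1 (h1 qr)).inter_of_isOpen_left
            (interior_eq_empty_iff_dense_compl.1 (h2 qr)) isClosed_closure.isOpen_compl)
      obtain ⟨x, hx, hx'⟩ := d2.inter_open_nonempty _ Metric.isOpen_ball
        ⟨c, Metric.mem_ball_self hε⟩
      rw [Set.mem_iInter] at hx'
      rcases hcov x hx with ⟨qr, h⟩ | ⟨qr, h⟩
      · exact (hx' qr).1 (subset_closure h)
      · exact (hx' qr).2 (subset_closure h)
    rcases hBaire with ⟨qr, h⟩ | ⟨qr, h⟩
    · obtain ⟨x, hx⟩ := ih _ (hB qr) h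
      have hxB : B qr x := interior_subset (s := {x | B qr x}) hx
      obtain ⟨t, ht⟩ := exists_between hxB.1
      refine ⟨Fin.cons t x, ?_⟩
      rw [mem_interior]
      refine ⟨_, ?_, hO (interior {x | B qr x}) qr.1 qr.2 isOpen_interior, ?_⟩
      · rintro y ⟨hy0, hy⟩
        have hyB : B qr _ := interior_subset (s := {x | B qr x}) hy
        have := hyB.2 (y 0) hy0
        rwa [hcons] at this
      · exact ⟨ht, by simpa using hx⟩
    · obtain ⟨x, hx⟩ := ih _ (hC qr) h
      have hxC : C qr x := interior_subset (s := {x | C qr x}) hx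
      obtain ⟨t, ht⟩ := exists_between hxC.1.1.1
      exfalso
      have := hcl t (hxC.1.1.2 ht) x hxC.1.2
      rw [mem_closure_iff] at this
      obtain ⟨y, ⟨hy0, hy⟩, hyP⟩ := this _ (hO (interior {x | C qr x}) qr.1 qr.2 isOpen_interior)
        ⟨ht, by simpa using hx⟩
      have hyC : C qr _ := interior_subset (s := {x | C qr x}) hy
      have := hyC.2 (y 0) hy0
      rw [hcons] at this
      exact this hyP

theorem dense_interior (hL : DMinimal L) {n : ℕ} {P : (Fin n → ℝ) → Prop} (hP : DP L P)
    (hd : Dense {x | P x}) : Dense (interior {x | P x}) := by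
  rw [← compl_compl (interior {x | P x}), ← interior_eq_empty_iff_dense_compl,
    ← closure_compl]
  by_contra hne
  have := dich hL n (fun x => ¬ P x) (dp_not hP) (Set.nonempty_iff_ne_empty.2 hne)
  have h2 : interior {x | ¬ P x} = ∅ := by
    rw [interior_eq_empty_iff_dense_compl]
    convert hd using 1
    ext x
    simp
  rw [h2] at this
  exact Set.not_nonempty_empty this

theorem dp_interior (h : ExpandsOrderedField L) {n : ℕ} {P : (Fin n → ℝ) → Prop} (hP : DP L P) :
    DP L (fun x => x ∈ interior {x | P x}) := by
  have h1 : DP L (fun x : Fin n → ℝ => ∃ δ : ℝ, 0 < δ ∧ ∀ y : Fin n → ℝ,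
      (∀ i, |y i - x i| < δ) → P y) := by
    refine dp_exR (dp_and (dp_lt h (df_const _) (df_var _)) (dp_allT (dp_imp (dp_fin fun i => ?_)
      (dp_comp hP fun b => df_var _))))
    exact dp_lt h (df_abs h (df_sub h (df_var _) (df_var _))) (df_var _)
  refine dp_congr h1 fun x => ?_
  rw [mem_interior_iff_mem_nhds, Metric.mem_nhds_iff]
  refine exists_congr fun δ => and_congr_right fun hδ => forall_congr' fun y => ?_
  rw [Metric.mem_ball, dist_pi_lt_iff hδ]
  rfl

theorem dp_continuousAt (h : ExpandsOrderedField L) {n : ℕ} {f : (Fin n → ℝ) → ℝ} (hf : DF L f) :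
    DP L (fun x => ContinuousAt f x) := by
  have h1 : DP L (fun x : Fin n → ℝ => ∀ ε : ℝ, 0 < ε → ∃ δ : ℝ, 0 < δ ∧ ∀ y : Fin n → ℝ,
      (∀ i, |y i - x i| < δ) → |f y - f x| < ε) := by
    refine dp_allR (dp_imp (dp_lt h (df_const _) (df_var _)) (dp_exR (dp_and
      (dp_lt h (df_const _) (df_var _)) (dp_allT (dp_imp (dp_fin fun i => ?_) ?_)))))
    · exact dp_lt h (df_abs h (df_sub h (df_var _) (df_var _))) (df_var _)
    · exact dp_lt h (df_abs h (df_sub h (df_comp hf fun b => df_var _)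
        (df_comp hf fun b => df_var _))) (df_var _)
  refine dp_congr h1 fun x => ?_
  rw [Metric.continuousAt_iff]
  refine forall_congr' fun ε => forall_congr' fun hε => exists_congr fun δ =>
    and_congr_right fun hδ => forall_congr' fun y => ?_
  rw [dist_pi_lt_iff hδ]
  rfl

theorem dense_continuousAt (hL : DMinimal L) {n : ℕ} {f : (Fin n → ℝ) → ℝ} (hf : DF L f) :
    Dense {x | ContinuousAt f x} := by
  let P : ℚ × ℚ → (Fin n → ℝ) → Prop := fun qr x => (qr.1 : ℝ) < f x ∧ f x < qr.2
  have hP : ∀ qr, DP L (P qr) := fun qr =>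
    dp_and (dp_lt hL.1 (df_const _) hf) (dp_lt hL.1 hf (df_const _))
  let N : ℚ × ℚ → (Fin n → ℝ) → Prop := fun qr x => P qr x ∧ ¬ x ∈ interior {x | P qr x}
  have hN : ∀ qr, DP L (N qr) := fun qr => dp_and (hP qr) (dp_not (dp_interior hL.1 (hP qr)))
  have hNe : ∀ qr, interior (closure {x | N qr x}) = ∅ := by
    intro qr
    by_contra hne
    obtain ⟨x, hx⟩ := dich hL n _ (hN qr) (Set.nonempty_iff_ne_empty.2 hne)
    have h1 : {x | N qr x} ⊆ {x | P qr x} := fun y hy => hy.1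
    have h2 := interior_mono h1 hx
    have h3 : N qr x := interior_subset (s := {x | N qr x}) hx
    exact h3.2 h2
  have d : Dense (⋂ qr, (closure {x | N qr x})ᶜ) :=
    dense_iInter_of_isOpen (fun qr => isClosed_closure.isOpen_compl)
      (fun qr => interior_eq_empty_iff_dense_compl.1 (hNe qr))
  refine d.mono fun x hx => ?_
  rw [Set.mem_iInter] at hx
  rw [Set.mem_setOf_eq, Metric.continuousAt_iff']
  intro ε hε
  obtain ⟨q, hq1, hq2⟩ := exists_rat_btwn (show f x - ε < f x by linarith)
  obtain ⟨r, hr1, hr2⟩ := exists_rat_btwn (show f x < f x + ε by linarith)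
  have hPx : P (q, r) x := ⟨hq2, hr1⟩
  have : x ∈ interior {x | P (q, r) x} := by
    by_contra hno
    exact hx (q, r) (subset_closure (show N (q, r) x from ⟨hPx, hno⟩))
  filter_upwards [mem_interior_iff_mem_nhds.1 this] with y hy
  have hy' : (q : ℝ) < f y ∧ f y < r := hy
  rw [Real.dist_eq, abs_lt]
  constructor <;> linarith [hy'.1, hy'.2]

end Dichotomy

section Diff

variable {L}

theorem dich1 (hL : DMinimal L) {Q : ℝ → Prop} (hQ : DP L (fun z : Fin 1 → ℝ => Q (z 0)))
    {a b : ℝ} (hab : a < b) :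
    (∃ c d, c < d ∧ Ioo c d ⊆ Ioo a b ∧ ∀ t ∈ Ioo c d, Q t) ∨
    (∃ c d, c < d ∧ Ioo c d ⊆ Ioo a b ∧ ∀ t ∈ Ioo c d, ¬ Q t) :=
  dich_fiber hL (k := 0) (P := fun z => Q (z (Sum.inr ())))
    (dp_comp hQ (g := fun _ z => z (Sum.inr ())) fun b => df_var _) Fin.elim0 hab

theorem dp_isLocalMax (h : ExpandsOrderedField L) {g : ℝ → ℝ}
    (hg : DF L (fun z : Fin 1 → ℝ => g (z 0))) :
    DP L (fun z : Fin 1 → ℝ => IsLocalMax g (z 0)) := by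
  have hgc : ∀ {β : Type} {u : (β → ℝ) → ℝ}, DF L u → DF L (fun z => g (u z)) :=
    fun hu => df_comp hg (g := fun _ z => _) fun _ => hu
  have h1 : DP L (fun z : Fin 1 → ℝ => ∃ δ : ℝ, 0 < δ ∧ ∀ y : ℝ, |y - z 0| < δ → g y ≤ g (z 0)) :=
    dp_exR (dp_and (dp_lt h (df_const _) (df_var _)) (dp_allR (dp_imp
      (dp_lt h (df_abs h (df_sub h (df_var _) (df_var _))) (df_var _))
      (dp_le h (hgc (df_var _)) (hgc (df_var _))))))
  refine dp_congr h1 fun z => ?_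
  rw [IsLocalMax, IsMaxFilter, Metric.eventually_nhds_iff]
  rfl

theorem countable_localMax (g : ℝ → ℝ) : (g '' {t | IsLocalMax g t}).Countable := by
  have : g '' {t | IsLocalMax g t} ⊆ ⋃ qr : ℚ × ℚ,
      {v | ∃ t ∈ Ioo (qr.1 : ℝ) qr.2, g t = v ∧ ∀ s ∈ Ioo (qr.1 : ℝ) qr.2, g s ≤ g t} := by
    rintro v ⟨t, ht, rfl⟩
    have ht' : IsLocalMax g t := ht
    rw [IsLocalMax, IsMaxFilter, Metric.eventually_nhds_iff] at ht'
    obtain ⟨δ, hδ, hm⟩ := ht'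
    obtain ⟨q, hq1, hq2⟩ := exists_rat_btwn (show t - δ < t by linarith)
    obtain ⟨r, hr1, hr2⟩ := exists_rat_btwn (show t < t + δ by linarith)
    rw [Set.mem_iUnion]
    refine ⟨(q, r), t, ⟨hq2, hr1⟩, rfl, fun s hs => hm ?_⟩
    rw [Real.dist_eq, abs_lt]
    have h1 : (q : ℝ) < s := hs.1
    have h2 : s < (r : ℝ) := hs.2
    constructor <;> linarith
  refine Set.Countable.mono this (Set.countable_iUnion fun qr => Set.Subsingleton.countable ?_)
  rintro v ⟨t, ht, rfl, hm⟩ w ⟨s, hs, rfl, hm'⟩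
  exact le_antisymm (hm' t ht) (hm s hs)

theorem diff_of_const {g : ℝ → ℝ} {a b : ℝ} (hc : ContinuousOn g (Ioo a b))
    (hcount : (g '' Ioo a b).Countable) : ∀ t ∈ Ioo a b, DifferentiableAt ℝ g t := by
  intro t ht
  have hs : (g '' Ioo a b).Subsingleton :=
    hcount.isTotallyDisconnected _ le_rfl (isPreconnected_Ioo.image g hc)
  have : g =ᶠ[𝓝 t] fun _ => g t := by
    filter_upwards [isOpen_Ioo.mem_nhds ht] with s hs'
    exact hs ⟨s, hs', rfl⟩ ⟨t, ht, rfl⟩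
  exact this.differentiableAt_iff.2 (differentiableAt_const _)

theorem diff_of_monotoneOn {g : ℝ → ℝ} {a b : ℝ} (hab : a < b) (hm : MonotoneOn g (Ioo a b)) :
    ∃ t ∈ Ioo a b, DifferentiableAt ℝ g t := by
  have h := hm.ae_differentiableWithinAt_of_mem
  by_contra hcon
  push Not at hcon
  have h0 : MeasureTheory.volume (Ioo a b) = 0 := by
    refine MeasureTheory.measure_mono_null ?_ h
    intro t ht hh
    exact hcon t ht ((hh ht).differentiableAt (isOpen_Ioo.mem_nhds ht))
  rw [Real.volume_Ioo, ENNReal.ofReal_eq_zero] at h0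
  linarith

theorem diff_one (hL : DMinimal L) {g : ℝ → ℝ} (hg : DF L (fun z : Fin 1 → ℝ => g (z 0)))
    {a b : ℝ} (hab : a < b) : ∃ t ∈ Ioo a b, DifferentiableAt ℝ g t := by
  have hdc := dense_interior hL (dp_continuousAt hL.1 hg) (dense_continuousAt hL hg)
  obtain ⟨a₁, b₁, hab₁, hs₁, hc⟩ : ∃ c d, c < d ∧ Ioo c d ⊆ Ioo a b ∧
      ContinuousOn g (Ioo c d) := by
    obtain ⟨z, hz, hz'⟩ := hdc.inter_open_nonempty {z : Fin 1 → ℝ | z 0 ∈ Ioo a b}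
      (isOpen_Ioo.preimage (continuous_apply 0))
      ⟨fun _ => (a + b) / 2, by constructor <;> simp <;> linarith⟩
    have ho : IsOpen {t : ℝ | t ∈ Ioo a b ∧ (fun _ => t : Fin 1 → ℝ) ∈
        interior {x | ContinuousAt (fun z : Fin 1 → ℝ => g (z 0)) x}} :=
      isOpen_Ioo.inter (isOpen_interior.preimage (continuous_pi fun _ => continuous_id))
    have hz2 : (fun _ => z 0 : Fin 1 → ℝ) = z := by
      funext i
      rw [Subsingleton.elim i 0]
    obtain ⟨ε, hε, hb⟩ := Metric.mem_nhds_iff.1 (ho.mem_nhds (x := z 0) ⟨hz, by rwa [hz2]⟩)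
    rw [Real.ball_eq_Ioo] at hb
    refine ⟨z 0 - ε, z 0 + ε, by linarith, fun t ht => (hb ht).1, fun t ht => ?_⟩
    have h1 : ContinuousAt (fun z : Fin 1 → ℝ => g (z 0)) (fun _ => t) :=
      interior_subset (s := {x | ContinuousAt (fun z : Fin 1 → ℝ => g (z 0)) x}) (hb ht).2
    have h2 : ContinuousAt (fun s : ℝ => (fun _ => s : Fin 1 → ℝ)) t :=
      (continuous_pi fun _ => continuous_id).continuousAt
    exact (ContinuousAt.comp (f := fun s : ℝ => (fun _ => s : Fin 1 → ℝ)) (x := t) h1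
      h2).continuousWithinAt
  have hneg : DF L (fun z : Fin 1 → ℝ => (fun t => 0 - g t) (z 0)) := df_sub hL.1 (df_const 0) hg
  rcases dich1 hL (Q := fun t => IsLocalMax g t) (dp_isLocalMax hL.1 hg) hab₁ with
    ⟨c, d, hcd, hs, h⟩ | ⟨a₂, b₂, hab₂, hs₂, hM⟩
  · obtain ⟨t, ht⟩ := exists_between hcd
    exact ⟨t, hs₁ (hs ht), diff_of_const (hc.mono hs) ((countable_localMax g).mono
      (Set.image_mono h)) t ht⟩
  rcases dich1 hL (Q := fun t => IsLocalMax (fun t => 0 - g t) t)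
      (dp_isLocalMax hL.1 hneg) hab₂ with
    ⟨c, d, hcd, hs, h⟩ | ⟨a₃, b₃, hab₃, hs₃, hm⟩
  · obtain ⟨t, ht⟩ := exists_between hcd
    have h1 := diff_of_const (g := fun t => 0 - g t) (continuousOn_const.sub
      (hc.mono (hs.trans hs₂))) ((countable_localMax (fun t => 0 - g t)).mono
      (Set.image_mono h)) t ht
    refine ⟨t, hs₁ (hs₂ (hs ht)), ?_⟩
    have h2 := h1.neg
    have h3 : (-fun t => 0 - g t) = g := by
      funext t
      simp
    rwa [h3] at h2
  · have hc3 : ContinuousOn g (Ioo a₃ b₃) := hc.mono (hs₃.trans hs₂)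
    have key : ∀ x ∈ Ioo a₃ b₃, ∀ y ∈ Ioo a₃ b₃, x < y → g x ≠ g y := by
      intro x hx y hy hxy he
      have hsub : Icc x y ⊆ Ioo a₃ b₃ := fun t ht =>
        ⟨lt_of_lt_of_le hx.1 ht.1, lt_of_le_of_lt ht.2 hy.2⟩
      obtain ⟨t, ht, hext⟩ := exists_isLocalExtr_Ioo hxy (hc3.mono hsub) he
      have ht3 := hsub (Ioo_subset_Icc_self ht)
      rcases hext with h1 | h1
      · apply hm t ht3
        filter_upwards [h1] with s hs
        exact sub_le_sub_left hs 0
      · exact hM t (hs₃ ht3) h1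
    have hinj : InjOn g (Ioo a₃ b₃) := by
      intro x hx y hy he
      rcases lt_trichotomy x y with h1 | h1 | h1
      · exact absurd he (key x hx y hy h1)
      · exact h1
      · exact absurd he.symm (key y hy x hx h1)
    have hsub3 := hs₃.trans (hs₂.trans hs₁)
    rcases ContinuousOn.strictMonoOn_of_injOn_Ioo hab₃ hc3 hinj with h1 | h1
    · obtain ⟨t, ht, h2⟩ := diff_of_monotoneOn hab₃ h1.monotoneOn
      exact ⟨t, hsub3 ht, h2⟩
    · obtain ⟨t, ht, h2⟩ := diff_of_monotoneOn (g := -g) hab₃ h1.antitoneOn.neg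
      refine ⟨t, hsub3 ht, ?_⟩
      simpa using h2.neg

/-- the relation "the `i`-th partial derivative of `f` at `x` is `s`" -/
def HasPD {n : ℕ} (f : (Fin n → ℝ) → ℝ) (i : Fin n) (x : Fin n → ℝ) (s : ℝ) : Prop :=
  HasDerivAt (fun t => f (Function.update x i t)) s (x i)

theorem dp_hasPD (h : ExpandsOrderedField L) {n : ℕ} {f : (Fin n → ℝ) → ℝ} (hf : DF L f)
    (i : Fin n) {β : Type} [Finite β] {u : Fin n → (β → ℝ) → ℝ} {s : (β → ℝ) → ℝ}
    (hu : ∀ j, DF L (u j)) (hs : DF L s) :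
    DP L (fun z => HasPD f i (fun j => u j z) (s z)) := by
  have h0 : DP L (fun z : Fin n ⊕ Unit → ℝ =>
      HasPD f i (fun a => z (Sum.inl a)) (z (Sum.inr ()))) := by
    have h1 : DP L (fun z : Fin n ⊕ Unit → ℝ => ∀ ε : ℝ, 0 < ε → ∃ δ : ℝ, 0 < δ ∧ ∀ t : ℝ,
        |t - z (Sum.inl i)| < δ →
        |f (fun j => Function.update (fun a => z (Sum.inl a)) i t j) - f (fun a => z (Sum.inl a)) -
          (t - z (Sum.inl i)) * z (Sum.inr ())| ≤ ε * |t - z (Sum.inl i)|) := by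
      refine dp_allR (dp_imp (dp_lt h (df_const _) (df_var _)) (dp_exR (dp_and
        (dp_lt h (df_const _) (df_var _)) (dp_allR (dp_imp
        (dp_lt h (df_abs h (df_sub h (df_var _) (df_var _))) (df_var _))
        (dp_le h (df_abs h (df_sub h (df_sub h (df_comp hf fun b => ?_)
          (df_comp hf fun b => df_var _)) (df_mul h (df_sub h (df_var _) (df_var _)) (df_var _))))
          (df_mul h (df_var _) (df_abs h (df_sub h (df_var _) (df_var _))))))))))
      exact df_update i (df_var _) (fun a => df_var _) b
    refine dp_congr h1 fun z => ?_
    rw [HasPD, hasDerivAt_iff_isLittleO, Asymptotics.isLittleO_iff]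
    refine forall_congr' fun ε => forall_congr' fun hε => ?_
    rw [Metric.eventually_nhds_iff]
    simp only [Function.update_eq_self, Real.norm_eq_abs, smul_eq_mul, Real.dist_eq]
  exact dp_comp h0 (g := fun b => Sum.elim u (fun _ => s) b) (by
    rintro (b | b)
    · exact hu b
    · exact hs)

/-- the `i`-th partial derivative -/
def pd {n : ℕ} (f : (Fin n → ℝ) → ℝ) (i : Fin n) (x : Fin n → ℝ) : ℝ :=
  deriv (fun t => f (Function.update x i t)) (x i)

theorem df_pd (h : ExpandsOrderedField L) {n : ℕ} {f : (Fin n → ℝ) → ℝ} (hf : DF L f)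
    (i : Fin n) : DF L (pd f i) := by
  apply df_of_graph
  have h1 : DP L (fun z : Option (Fin n) → ℝ => HasPD f i (fun a => z (some a)) (z none) ∨
      ((¬ ∃ s, HasPD f i (fun a => z (some a)) s) ∧ z none = 0)) :=
    dp_or (dp_hasPD h hf i (fun j => df_var _) (df_var _))
      (dp_and (dp_not (dp_exR (dp_hasPD h hf i (fun j => df_var _) (df_var _))))
        (dp_eq (df_var _) (df_const _)))
  refine dp_congr h1 fun z => ?_
  constructor
  · rintro (h1 | ⟨h1, h2⟩)
    · exact HasDerivAt.deriv h1
    · rw [h2]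
      apply deriv_zero_of_not_differentiableAt
      intro hd
      exact h1 ⟨_, hd.hasDerivAt⟩
  · intro he
    by_cases hd : DifferentiableAt ℝ (fun t => f (Function.update (fun a => z (some a)) i t))
      (z (some i))
    · left
      rw [← he]
      exact hd.hasDerivAt
    · right
      refine ⟨fun ⟨s, hs⟩ => hd (HasDerivAt.differentiableAt hs), ?_⟩
      rw [← he]
      exact deriv_zero_of_not_differentiableAt hd

theorem dense_pd (hL : DMinimal L) {n : ℕ} {f : (Fin n → ℝ) → ℝ} (hf : DF L f) (i : Fin n) :
    Dense {x | ∃ s, HasPD f i x s} := by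
  rw [Metric.dense_iff]
  intro x r hr
  obtain ⟨t, ht, hd⟩ := diff_one hL (g := fun t => f (fun j => Function.update x i t j))
    (df_comp hf fun b => df_update i (df_var _) (x := fun a _ => x a) (fun a => df_const _) b)
    (show x i - r < x i + r by linarith)
  refine ⟨Function.update x i t, ?_, ?_⟩
  · rw [Metric.mem_ball, dist_pi_lt_iff hr]
    intro j
    by_cases hj : j = i
    · subst hj
      rw [Function.update_self, Real.dist_eq, abs_lt]
      constructor <;> linarith [ht.1, ht.2]
    · simpa [hj] using hr
  · refine ⟨deriv (fun t => f (Function.update x i t)) t, ?_⟩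
    unfold HasPD
    simp only [Function.update_idem, Function.update_self]
    exact hd.hasDerivAt

theorem hasFDerivAt_of_pd {n : ℕ} {f : (Fin n → ℝ) → ℝ} {x : Fin n → ℝ}
    {g : Fin n → (Fin n → ℝ) → ℝ} (hpd : ∀ᶠ y in 𝓝 x, ∀ i, HasPD f i y (g i y))
    (hg : ∀ i, ContinuousAt (g i) x) :
    HasFDerivAt f (∑ i, g i x • (ContinuousLinearMap.proj i : (Fin n → ℝ) →L[ℝ] ℝ)) x := by
  rw [hasFDerivAt_iff_isLittleO, Asymptotics.isLittleO_iff]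
  intro ε₀ hε₀
  set ε : ℝ := ε₀ / (n + 1) with hε_def
  have hn1 : (0 : ℝ) < n + 1 := by positivity
  have hε : 0 < ε := by positivity
  have hg' : ∀ᶠ y in 𝓝 x, ∀ i, dist (g i y) (g i x) < ε := by
    rw [eventually_all]
    intro i
    exact Metric.continuousAt_iff'.1 (hg i) ε hε
  obtain ⟨δ, hδ, hb⟩ := Metric.eventually_nhds_iff.1 (hpd.and hg')
  rw [Metric.eventually_nhds_iff]
  refine ⟨δ, hδ, fun y hy => ?_⟩
  rw [dist_pi_lt_iff hδ] at hy
  have key : ∀ s : Finset (Fin n), |f (s.piecewise y x) - f x - ∑ i ∈ s, g i x * (y i - x i)| ≤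
      ∑ i ∈ s, ε * |y i - x i| := by
    intro s
    induction s using Finset.induction_on with
    | empty => simp
    | insert a s ha ih =>
      rw [Finset.sum_insert ha, Finset.sum_insert ha, Finset.piecewise_insert]
      set z : Fin n → ℝ := s.piecewise y x with hz
      have hza : z a = x a := Finset.piecewise_eq_of_notMem _ _ _ ha
      have hza' : Function.update z a (x a) = z := by rw [← hza, Function.update_eq_self]
      have hin : ∀ t ∈ uIcc (x a) (y a), ∀ j, dist (Function.update z a t j) (x j) < δ := by
        intro t ht j
        by_cases hj : j = a
        · subst hj
          rw [Function.update_self, Real.dist_eq]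
          have h1 := Set.abs_sub_left_of_mem_uIcc ht
          have h2 := hy j
          rw [Real.dist_eq] at h2
          exact lt_of_le_of_lt h1 h2
        · rw [Function.update_of_ne hj]
          by_cases hjs : j ∈ s
          · rw [hz, Finset.piecewise_eq_of_mem _ _ _ hjs]
            exact hy j
          · rw [hz, Finset.piecewise_eq_of_notMem _ _ _ hjs, dist_self]
            exact hδ
      have hmv := Convex.norm_image_sub_le_of_norm_hasDerivWithin_le
        (f := fun t => f (Function.update z a t) - g a x * t)
        (f' := fun t => g a (Function.update z a t) - g a x)
        (s := uIcc (x a) (y a)) (C := ε) (x := x a) (y := y a)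
        (by
          intro t ht
          have h1 := (hb ((dist_pi_lt_iff hδ).2 (hin t ht))).1 a
          unfold HasPD at h1
          simp only [Function.update_idem, Function.update_self] at h1
          have h2 : HasDerivAt (fun t : ℝ => g a x * t) (g a x) t := by
            simpa using (hasDerivAt_id t).const_mul (g a x)
          exact (h1.sub h2).hasDerivWithinAt)
        (by
          intro t ht
          exact ((hb ((dist_pi_lt_iff hδ).2 (hin t ht))).2 a).le)
        (convex_uIcc _ _) left_mem_uIcc right_mem_uIcc
      simp only [hza', Real.norm_eq_abs] at hmv
      have : f (Function.update z a (y a)) - f x -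
          (g a x * (y a - x a) + ∑ i ∈ s, g i x * (y i - x i)) =
          (f (Function.update z a (y a)) - g a x * y a - (f z - g a x * x a)) +
          (f z - f x - ∑ i ∈ s, g i x * (y i - x i)) := by ring
      rw [this]
      exact (abs_add_le _ _).trans (add_le_add hmv ih)
  have h1 := key Finset.univ
  rw [Finset.piecewise_univ] at h1
  have h2 : ∑ i : Fin n, ε * |y i - x i| ≤ ∑ i : Fin n, ε * ‖y - x‖ :=
    Finset.sum_le_sum fun i _ => mul_le_mul_of_nonneg_left (norm_le_pi_norm (y - x) i) hε.le
  have h3 : ∑ i : Fin n, ε * ‖y - x‖ ≤ ε₀ * ‖y - x‖ := by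
    simp only [Finset.sum_const, Finset.card_univ, Fintype.card_fin, nsmul_eq_mul]
    rw [← mul_assoc]
    refine mul_le_mul_of_nonneg_right ?_ (norm_nonneg _)
    rw [hε_def, mul_div_assoc', div_le_iff₀ hn1]
    nlinarith
  refine le_trans (le_of_eq ?_) (h1.trans (h2.trans h3))
  simp

theorem contDiff_dense (hL : DMinimal L) {n : ℕ} : ∀ (p : ℕ) (f : (Fin n → ℝ) → ℝ), DF L f →
    ∃ V : Set (Fin n → ℝ), DP L (fun x => x ∈ V) ∧ IsOpen V ∧ Dense V ∧ ContDiffOn ℝ p f V := by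
  intro p
  induction p with
  | zero =>
    intro f hf
    refine ⟨interior {x | ContinuousAt f x}, dp_interior hL.1 (dp_continuousAt hL.1 hf),
      isOpen_interior, dense_interior hL (dp_continuousAt hL.1 hf) (dense_continuousAt hL hf), ?_⟩
    rw [Nat.cast_zero, contDiffOn_zero]
    intro x hx
    have : ContinuousAt f x := interior_subset (s := {x | ContinuousAt f x}) hx
    exact this.continuousWithinAt
  | succ p ih =>
    intro f hf
    choose V hVd hVo hVD hVc using fun i : Fin n => ih (pd f i) (df_pd hL.1 hf i)
    have hX : ∀ i : Fin n, DP L (fun x => ∃ s, HasPD f i x s) := fun i =>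
      dp_exR (dp_hasPD hL.1 hf i (fun j => df_var _) (df_var _))
    set X : Fin n → Set (Fin n → ℝ) := fun i => interior {x | ∃ s, HasPD f i x s} with hXdef
    have hOi : ∀ i, IsOpen (V i ∩ X i) := fun i => (hVo i).inter isOpen_interior
    have hopen : IsOpen (⋂ i, (V i ∩ X i)) := isOpen_iInter_of_finite hOi
    have hmemP : ∀ y ∈ ⋂ i, (V i ∩ X i), ∀ i, HasPD f i y (pd f i y) := by
      intro y hy i
      have h1 : ∃ s, HasPD f i y s :=
        interior_subset (s := {x | ∃ s, HasPD f i x s}) ((Set.mem_iInter.1 hy i).2)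
      obtain ⟨s, hs⟩ := h1
      have : pd f i y = s := HasDerivAt.deriv hs
      rw [this]
      exact hs
    have hfd : ∀ x ∈ ⋂ i, (V i ∩ X i), HasFDerivAt f
        (∑ i, pd f i x • (ContinuousLinearMap.proj i : (Fin n → ℝ) →L[ℝ] ℝ)) x := by
      intro x hx
      apply hasFDerivAt_of_pd
      · filter_upwards [hopen.mem_nhds hx] with y hy
        exact hmemP y hy
      · intro i
        exact (hVc i).continuousOn.continuousAt ((hVo i).mem_nhds (Set.mem_iInter.1 hx i).1)
    refine ⟨⋂ i, (V i ∩ X i), ?_, hopen, ?_, ?_⟩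
    · refine dp_congr (dp_fin fun i => dp_and (hVd i) (dp_interior hL.1 (hX i))) fun x => ?_
      rw [Set.mem_iInter]
      rfl
    · exact dense_iInter_of_isOpen hOi fun i => (hVD i).inter_of_isOpen_left
        (dense_interior hL (hX i) (dense_pd hL hf i)) (hVo i)
    · rw [Nat.cast_succ, contDiffOn_succ_iff_fderiv_of_isOpen hopen]
      refine ⟨fun x hx => (hfd x hx).differentiableAt.differentiableWithinAt, by simp, ?_⟩
      have : ContDiffOn ℝ p
          (fun x => ∑ i, pd f i x • (ContinuousLinearMap.proj i : (Fin n → ℝ) →L[ℝ] ℝ))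
          (⋂ i, (V i ∩ X i)) := by
        apply ContDiffOn.sum
        intro i _
        exact ((hVc i).mono fun x hx => (Set.mem_iInter.1 hx i).1).smul contDiffOn_const
      exact this.congr fun x hx => (hfd x hx).fderiv

end Diff

/-- a definable function is `C^p` off a definable closed small set. -/
theorem stmt16 (L : FirstOrder.Language) [L.Structure ℝ] (hL : DMinimal L) (p n : ℕ)
    (hp : 1 ≤ p) (U : Set (Fin n → ℝ)) (hUdef : IsDef L U) (hUo : IsOpen U)
    (f : (Fin n → ℝ) → ℝ) (hfdef : IsDefFunOn L U f) :
    ∃ D : Set (Fin n → ℝ), IsDef L D ∧ D ⊆ U ∧ closure D ∩ U ⊆ D ∧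
      interior D = ∅ ∧ ContDiffOn ℝ p f (U \ D) := by
  let F : (Fin n → ℝ) → ℝ := fun x => if x ∈ U then f x else 0
  have hU : DP L (fun x => x ∈ U) := hUdef
  have hG : DP L (fun z : Fin n ⊕ Unit → ℝ => (fun i => z (Sum.inl i)) ∈ U ∧
    z (Sum.inr ()) = f (fun i => z (Sum.inl i))) := hfdef
  have hF : DF L F := by
    apply df_of_graph
    have h1 : DP L (fun z : Option (Fin n) → ℝ =>
        ((fun i => z (some i)) ∈ U ∧ z none = f (fun i => z (some i))) ∨
        ((¬ (fun i => z (some i)) ∈ U) ∧ z none = 0)) :=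
      dp_or (dp_comp hG (g := fun b => Sum.elim (fun (i : Fin n) z => z (some i))
          (fun _ z => z none) b) (by
            rintro (b | b)
            · exact df_var _
            · exact df_var _))
        (dp_and (dp_not (dp_comp hU fun b => df_var _)) (dp_eq (df_var _) (df_const _)))
    refine dp_congr h1 fun z => ?_
    by_cases hz : (fun i => z (some i)) ∈ U
    · simp [F, hz, eq_comm]
    · simp [F, hz, eq_comm]
  obtain ⟨V, hVd, hVo, hVD, hVc⟩ := contDiff_dense hL p F hF
  refine ⟨U \ V, dp_and hU (dp_not hVd), fun x hx => hx.1, ?_, ?_, ?_⟩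
  · rintro x ⟨hx, hxU⟩
    refine ⟨hxU, ?_⟩
    have h1 : closure (U \ V) ⊆ Vᶜ :=
      closure_minimal (fun y hy => hy.2) hVo.isClosed_compl
    exact h1 hx
  · have h1 : interior (U \ V) ⊆ interior Vᶜ := interior_mono fun y hy => hy.2
    have h2 : interior Vᶜ = ∅ := interior_eq_empty_iff_dense_compl.2 (by rwa [compl_compl])
    rw [h2] at h1
    exact Set.subset_eq_empty h1 rfl
  · have h1 : U \ (U \ V) ⊆ V := fun x hx => by
      by_contra hxV
      exact hx.2 ⟨hx.1, hxV⟩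
    refine (hVc.mono h1).congr fun x hx => ?_
    simp [F, hx.1]

end DMinPaper
end
end

section
/- Suppose the structure on ℝ is d-minimal. Let f : X → Y be a definable surjective map between definable sets such that the dimension of the fiber f⁻¹(y) is a constant e independent of the choice of y ∈ Y. Then dim X = dim Y + e. -/
open FirstOrder Set Filter Topology
open scoped Classical

noncomputable section

namespace DMinPaper

variable (L : FirstOrder.Language) [L.Structure ℝ]

variable {E F : Type} [NormedAddCommGroup E] [NormedSpace ℝ E]
  [NormedAddCommGroup F] [NormedSpace ℝ F]

section helpers

variable {K : FirstOrder.Language} [K.Structure ℝ]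

theorem def_section {α β : Type} [Finite α] [Finite β] {A : Set ℝ} {T : Set (β ⊕ α → ℝ)}
    (hT : A.Definable K T) (a : β → ℝ) :
    (A ∪ Set.range a).Definable K {x : α → ℝ | Sum.elim a x ∈ T} := by
  have h1 : (A ∪ Set.range a).Definable K T := hT.mono Set.subset_union_left
  refine h1.preimage_map (F := fun x => Sum.elim a x) ?_
  rintro (i | i)
  · exact K.definableFun_const α (Or.inr ⟨i, rfl⟩)
  · exact (K.definableFun_var i).of_empty

theorem def_section1 {α : Type} [Finite α] {A : Set ℝ} {T : Set (Fin 1 ⊕ α → ℝ)}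
    (hT : A.Definable K T) (c : ℝ) :
    (insert c A).Definable K {x : α → ℝ | Sum.elim (fun _ => c) x ∈ T} := by
  refine (def_section hT (fun _ => c)).mono ?_
  rintro x (hx | ⟨i, rfl⟩)
  · exact Or.inr hx
  · exact Or.inl rfl

theorem def_family {α : Type} {A : Set ℝ} {c : ℝ} {S : Set (α → ℝ)}
    (hS : (insert c A).Definable K S) :
    ∃ T : Set (Fin 1 ⊕ α → ℝ), A.Definable K T ∧ S = {x | Sum.elim (fun _ => c) x ∈ T} := by
  obtain ⟨φ, rfl⟩ := definable_iff_exists_formula_sum.1 hS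
  let g : (insert c A : Set ℝ) ⊕ α → A ⊕ (Fin 1 ⊕ α) :=
    Sum.elim (fun a => if h : a.1 ∈ A then Sum.inl ⟨a.1, h⟩ else Sum.inr (Sum.inl 0))
      (fun i => Sum.inr (Sum.inr i))
  refine ⟨_, definable_iff_exists_formula_sum.2 ⟨φ.relabel g, rfl⟩, ?_⟩
  ext x
  simp only [Set.mem_ofPred_eq, Language.Formula.realize_relabel]
  refine iff_of_eq ?_
  congr 1
  ext i
  rcases i with ⟨a, ha⟩ | i
  · by_cases h : a ∈ A
    · simp [g, h]
    · have : a = c := by simpa [h] using ha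
      simp [g, this]
      split_ifs <;> simp
  · simp [g]

/-- small closure -/
def cl (K : FirstOrder.Language) [K.Structure ℝ] (A : Set ℝ) : Set ℝ :=
  {b | ∃ S : Set ℝ, A.Definable₁ K S ∧ S.Countable ∧ b ∈ S}

structure Good (K : FirstOrder.Language) [K.Structure ℝ] : Prop where
  cnt : Countable K.Symbols
  dich : ∀ S : Set ℝ, (Set.univ : Set ℝ).Definable₁ K S → S.Countable ∨ (interior S).Nonempty
  lt : (∅ : Set ℝ).Definable K {x : Fin 2 → ℝ | x 0 < x 1}
  rlt : ∀ q : ℚ, (∅ : Set ℝ).Definable₁ K (Set.Iio (q : ℝ))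
  rgt : ∀ q : ℚ, (∅ : Set ℝ).Definable₁ K (Set.Ioi (q : ℝ))

theorem subset_cl (A : Set ℝ) : A ⊆ cl K A := fun a ha =>
  ⟨{a}, Definable.singleton_of_mem K ha, Set.countable_singleton a, rfl⟩

theorem cl_mono {A B : Set ℝ} (h : A ⊆ B) : cl K A ⊆ cl K B :=
  fun _ ⟨S, h1, h2, h3⟩ => ⟨S, Definable.mono h1 h, h2, h3⟩

theorem cl_countable (hK : Good K) {A : Set ℝ} (hA : A.Countable) : (cl K A).Countable := by
  have := hK.cnt
  have : Countable A := hA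
  have : Countable (K[[A]].Formula (Fin 1)) := inferInstance
  have h : cl K A ⊆ ⋃ φ : K[[A]].Formula (Fin 1),
      {b | {t : ℝ | φ.Realize (fun _ => t)}.Countable ∧ φ.Realize (fun _ => b)} := by
    rintro b ⟨S, ⟨φ, hφ⟩, hc, hb⟩
    have key : ∀ t : ℝ, t ∈ S ↔ φ.Realize (fun _ => t) := fun t => by
      have := congrArg (fun s => (fun _ => t) ∈ s) hφ
      simpa using this
    refine Set.mem_iUnion.2 ⟨φ, ?_, (key b).1 hb⟩
    convert hc using 1
    ext t; exact (key t).symm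
  refine Set.Countable.mono h (Set.countable_iUnion fun φ => ?_)
  by_cases hc : {t : ℝ | φ.Realize (fun _ => t)}.Countable
  · exact hc.mono fun b hb => hb.2
  · convert Set.countable_empty
    ext b; simp [hc]

theorem def_lt (hK : Good K) {α : Type} (A : Set ℝ) (i j : α) :
    A.Definable K {v : α → ℝ | v i < v j} := by
  have := (hK.lt.mono (Set.empty_subset A)).preimage_comp (![i, j])
  simpa using this

theorem not_countable_of_interior {S : Set ℝ} (h : (interior S).Nonempty) : ¬ S.Countable := by
  intro hc
  obtain ⟨x, hx⟩ := h
  obtain ⟨y, hy, hy'⟩ := ((hc.mono interior_subset).dense_compl ℝ).inter_open_nonempty _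
    isOpen_interior ⟨x, hx⟩
  exact hy' hy

theorem interior_iff (S : Set ℝ) :
    (interior S).Nonempty ↔ ∃ p q : ℝ, p < q ∧ ∀ t, p < t → t < q → t ∈ S := by
  constructor
  · rintro ⟨x, hx⟩
    obtain ⟨l, u, hx', hs⟩ := mem_nhds_iff_exists_Ioo_subset.1 (mem_interior_iff_mem_nhds.1 hx)
    exact ⟨l, u, hx'.1.trans hx'.2, fun t h1 h2 => hs ⟨h1, h2⟩⟩
  · rintro ⟨p, q, hpq, h⟩
    obtain ⟨x, hx⟩ := exists_between hpq
    exact ⟨x, mem_interior_iff_mem_nhds.2 (mem_nhds_iff_exists_Ioo_subset.2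
      ⟨p, q, hx, fun t ht => h t ht.1 ht.2⟩)⟩

theorem def_interior (hK : Good K) {α : Type} [Finite α] {A : Set ℝ} {T : Set (α ⊕ Fin 1 → ℝ)}
    (hT : A.Definable K T) :
    A.Definable K {v : α → ℝ | (interior {t | Sum.elim v (fun _ => t) ∈ T}).Nonempty} := by
  have h1 : A.Definable K {w : (α ⊕ Fin 2) ⊕ Fin 1 → ℝ |
      w (Sum.inl (Sum.inr 0)) < w (Sum.inr 0) → w (Sum.inr 0) < w (Sum.inl (Sum.inr 1)) →
        w ∘ (Sum.map Sum.inl id) ∈ T} := by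
    have := ((def_lt hK A (Sum.inl (Sum.inr 0) : (α ⊕ Fin 2) ⊕ Fin 1) (Sum.inr 0)).himp
      ((def_lt hK A (Sum.inr 0) (Sum.inl (Sum.inr 1) : (α ⊕ Fin 2) ⊕ Fin 1)).himp
      (hT.preimage_comp (Sum.map Sum.inl id : _ → (α ⊕ Fin 2) ⊕ Fin 1))))
    convert this using 1
    ext w
    simp only [himp_eq, Set.sup_eq_union, Set.mem_union, Set.mem_compl_iff, Set.mem_ofPred_eq, Set.mem_preimage]
    tauto
  have h2 := ((def_lt hK A (Sum.inr 0 : α ⊕ Fin 2) (Sum.inr 1)).inter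
    h1.forall_of_finite).exists_of_finite
  convert h2 using 1
  ext v
  simp only [interior_iff, Set.mem_ofPred_eq, Set.mem_inter_iff, Sum.elim_inr, Sum.elim_inl]
  have e : ∀ (u : Fin 2 → ℝ) (w : Fin 1 → ℝ),
      Sum.elim (Sum.elim v u) w ∘ Sum.map Sum.inl id = Sum.elim v (fun _ => w 0) := by
    intro u w; ext (i | i)
    · simp
    · simp [Subsingleton.elim i 0]
  simp only [e]
  constructor
  · rintro ⟨p, q, h, h'⟩
    exact ⟨![p, q], by simpa using h, fun w h1 h2 => h' _ (by simpa using h1) (by simpa using h2)⟩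
  · rintro ⟨u, h, h'⟩
    exact ⟨u 0, u 1, h, fun t h1 h2 => h' (fun _ => t) h1 h2⟩

theorem def_fib {A : Set ℝ} {T : Set (Fin 1 ⊕ Fin 1 → ℝ)} (hT : A.Definable K T) (x : ℝ) :
    (insert x A).Definable₁ K {t | Sum.elim (fun _ => x) (fun _ => t) ∈ T} := by
  have := def_section1 hT x
  unfold Definable₁
  convert this using 1
  ext v
  have : v = fun _ => v 0 := by ext i; rw [Subsingleton.elim i 0]
  rw [Set.mem_ofPred_eq, Set.mem_ofPred_eq, Set.mem_ofPred_eq, ← this]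

theorem fib_countable_iff (hK : Good K) {A : Set ℝ} {T : Set (Fin 1 ⊕ Fin 1 → ℝ)}
    (hT : A.Definable K T) (x : ℝ) :
    {t : ℝ | Sum.elim (fun _ => x) (fun _ => t) ∈ T}.Countable ↔
      ¬ (interior {t : ℝ | Sum.elim (fun _ => x) (fun _ => t) ∈ T}).Nonempty := by
  constructor
  · intro h h'
    exact not_countable_of_interior h' h
  · intro h
    exact (hK.dich _ (Definable.mono (def_fib hT x) (Set.subset_univ _))).resolve_right h

theorem family1 (hK : Good K) {A : Set ℝ} {b c : ℝ} (hb : b ∈ cl K (insert c A)) :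
    ∃ T : Set (Fin 1 ⊕ Fin 1 → ℝ), A.Definable K T ∧
      Sum.elim (fun _ => c) (fun _ => b) ∈ T ∧
      ∀ x : ℝ, {t : ℝ | Sum.elim (fun _ => x) (fun _ => t) ∈ T}.Countable := by
  obtain ⟨S, hS, hc, hbS⟩ := hb
  obtain ⟨T, hT, hST⟩ := def_family hS
  have hN := (def_interior hK hT).compl.preimage_comp (Sum.inl : Fin 1 → Fin 1 ⊕ Fin 1)
  have key : ∀ t : ℝ, t ∈ S ↔ Sum.elim (fun _ => c) (fun _ => t) ∈ T := fun t => by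
    have := congrArg (fun s => (fun _ => t) ∈ s) hST
    simpa using this
  refine ⟨_, hT.inter hN, ⟨(key b).1 hbS, ?_⟩, ?_⟩
  · have : {t : ℝ | Sum.elim (fun _ => c) (fun _ => t) ∈ T}.Countable := by
      convert hc using 1; ext t; exact (key t).symm
    exact (fib_countable_iff hK hT c).1 this
  · intro x
    by_cases h : {t : ℝ | Sum.elim (fun _ => x) (fun _ => t) ∈ T}.Countable
    · exact h.mono fun t ht => ht.1
    · convert Set.countable_empty
      rw [Set.eq_empty_iff_forall_notMem]
      intro t ht
      exact h ((fib_countable_iff hK hT x).2 ht.2)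

theorem cl_trans (hK : Good K) {A : Set ℝ} {b c : ℝ} (hc : c ∈ cl K A)
    (hb : b ∈ cl K (insert c A)) : b ∈ cl K A := by
  obtain ⟨T, hT, hcb, hcnt⟩ := family1 hK hb
  obtain ⟨D, hD, hDc, hcD⟩ := hc
  refine ⟨⋃ x ∈ D, {t : ℝ | Sum.elim (fun _ => x) (fun _ => t) ∈ T}, ?_,
    hDc.biUnion fun x _ => hcnt x, Set.mem_biUnion hcD hcb⟩
  have hQ := (hT.inter (hD.preimage_comp (Sum.inl : Fin 1 → Fin 1 ⊕ Fin 1))).image_comp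
    (Sum.inr : Fin 1 → Fin 1 ⊕ Fin 1)
  unfold Definable₁
  convert hQ using 1
  ext v
  simp only [Set.mem_ofPred_eq, Set.mem_iUnion, Set.mem_image, Set.mem_inter_iff,
    Set.mem_preimage, Function.comp_apply]
  constructor
  · rintro ⟨x, hx, h⟩
    exact ⟨_, ⟨h, hx⟩, by ext i; simp [Subsingleton.elim i 0]⟩
  · rintro ⟨w, ⟨h1, h2⟩, rfl⟩
    refine ⟨_, h2, ?_⟩
    convert h1 using 1
    ext (i | i) <;> simp [Subsingleton.elim i 0]

theorem cl_exchange (hK : Good K) {A : Set ℝ} {b c : ℝ} (hb : b ∈ cl K (insert c A))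
    (hbA : b ∉ cl K A) : c ∈ cl K (insert b A) := by
  obtain ⟨T, hT, hcb, hcnt⟩ := family1 hK hb
  have hT' := hT.preimage_comp (Sum.swap : Fin 1 ⊕ Fin 1 → Fin 1 ⊕ Fin 1)
  have sw : ∀ x t : ℝ, (Sum.elim (fun _ => x) (fun _ => t) : Fin 1 ⊕ Fin 1 → ℝ) ∘ Sum.swap
      = Sum.elim (fun _ => t) (fun _ => x) := by
    intro x t; ext (i | i) <;> simp
  by_cases h : {t : ℝ | Sum.elim (fun _ => b) (fun _ => t) ∈ (fun g : Fin 1 ⊕ Fin 1 → ℝ => g ∘ Sum.swap) ⁻¹' T}.Countable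
  · exact ⟨_, def_fib hT' b, h, by simpa [sw] using hcb⟩
  · exfalso
    apply hbA
    refine ⟨{y | (interior {t : ℝ | Sum.elim (fun _ => y) (fun _ => t) ∈
      (fun g : Fin 1 ⊕ Fin 1 → ℝ => g ∘ Sum.swap) ⁻¹' T}).Nonempty}, ?_, ?_, ?_⟩
    · have := def_interior hK hT'
      unfold Definable₁
      convert this using 1
      ext v
      have : v = fun _ => v 0 := by ext i; rw [Subsingleton.elim i 0]
      simp only [Set.mem_ofPred_eq]
      rw [← this]
    · refine Set.Countable.mono ?_ (Set.countable_iUnion fun q : ℚ => hcnt q)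
      intro y hy
      obtain ⟨p, q, hpq, h⟩ := (interior_iff _).1 hy
      obtain ⟨r, h1, h2⟩ := exists_rat_btwn hpq
      refine Set.mem_iUnion.2 ⟨r, ?_⟩
      have := h r h1 h2
      simpa [sw] using this
    · by_contra h'
      exact h ((fib_countable_iff hK hT' b).2 h')

theorem cl_insert (hK : Good K) {A : Set ℝ} {c : ℝ} (hc : c ∈ cl K A) :
    cl K (insert c A) = cl K A :=
  Set.Subset.antisymm (fun _ hb => cl_trans hK hc hb) (cl_mono (Set.subset_insert _ _))

/-- rank of a list over a set -/
def rk (K : FirstOrder.Language) [K.Structure ℝ] : Set ℝ → List ℝ → ℕ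
  | _, [] => 0
  | A, a :: l => (if a ∈ cl K A then 0 else 1) + rk K (insert a A) l

theorem rk_insert (hK : Good K) {c : ℝ} (l : List ℝ) : ∀ {A : Set ℝ}, c ∈ cl K A →
    rk K (insert c A) l = rk K A l := by
  induction l with
  | nil => intro A _; rfl
  | cons a l ih =>
    intro A hc
    rw [rk, rk, cl_insert hK hc, Set.insert_comm, ih (cl_mono (Set.subset_insert _ _) hc)]

theorem rk_append (l₁ l₂ : List ℝ) : ∀ A : Set ℝ,
    rk K A (l₁ ++ l₂) = rk K A l₁ + rk K (A ∪ {x | x ∈ l₁}) l₂ := by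
  induction l₁ with
  | nil => intro A; simp [rk]
  | cons a l ih =>
    intro A
    rw [List.cons_append, rk, rk, ih, add_assoc]
    congr 3
    ext x; simp; tauto

theorem rk_zero (hK : Good K) {A : Set ℝ} (l : List ℝ) (h : ∀ x ∈ l, x ∈ cl K A) :
    rk K A l = 0 := by
  induction l with
  | nil => rfl
  | cons a l ih =>
    have ha := h a (by simp)
    rw [rk, rk_insert hK l ha, ih fun x hx => h x (by simp [hx])]
    simp [ha]

theorem rk_le (l : List ℝ) : ∀ A : Set ℝ, rk K A l ≤ l.length := by
  induction l with
  | nil => intro A; simp [rk]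
  | cons a l ih =>
    intro A
    rw [rk, List.length_cons]
    have := ih (insert a A)
    split_ifs <;> omega

theorem rk_perm (hK : Good K) {l l' : List ℝ} (h : l.Perm l') : ∀ A, rk K A l = rk K A l' := by
  induction h with
  | nil => intro A; rfl
  | cons a _ ih => intro A; rw [rk, rk, ih]
  | trans _ _ h1 h2 => intro A; rw [h1, h2]
  | swap a b l =>
    intro A
    rw [rk, rk, rk, rk, Set.insert_comm, ← add_assoc, ← add_assoc]
    congr 1
    by_cases ha : a ∈ cl K A
    · have := cl_mono (Set.subset_insert b A) ha
      rw [cl_insert hK ha]; simp [ha, this]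
    · by_cases hb : b ∈ cl K A
      · have := cl_mono (Set.subset_insert a A) hb
        rw [cl_insert hK hb]; simp [hb, this]
      · have : a ∈ cl K (insert b A) ↔ b ∈ cl K (insert a A) :=
          ⟨fun h => cl_exchange hK h ha, fun h => cl_exchange hK h hb⟩
        simp [ha, hb, this]

theorem rk_subperm (hK : Good K) {l l' : List ℝ} (h : l.Subperm l') (A : Set ℝ) :
    rk K A l ≤ rk K A l' := by
  obtain ⟨l₁, h1, h2⟩ := h
  obtain ⟨r, hr⟩ := h2.exists_perm_append
  rw [rk_perm hK hr, rk_append, rk_perm hK h1]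
  omega

theorem exists_indep (hK : Good K) (l : List ℝ) : ∀ A : Set ℝ,
    ∃ l', l'.Sublist l ∧ rk K A l' = l'.length ∧ l'.length = rk K A l := by
  induction l with
  | nil => intro A; exact ⟨[], by simp [rk]⟩
  | cons a l ih =>
    intro A
    by_cases ha : a ∈ cl K A
    · obtain ⟨l', h1, h2, h3⟩ := ih A
      refine ⟨l', h1.cons a, h2, ?_⟩
      rw [h3, rk, rk_insert hK l ha]
      simp [ha]
    · obtain ⟨l', h1, h2, h3⟩ := ih (insert a A)
      refine ⟨a :: l', h1.cons_cons a, ?_, ?_⟩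
      · rw [rk, h2]; simp [ha, add_comm]
      · rw [rk, ← h3]; simp [ha, add_comm]

theorem exists_rat_box {n : ℕ} {U : Set (Fin n → ℝ)} (hU : (interior U).Nonempty) :
    ∃ q r : Fin n → ℚ, {x : Fin n → ℝ | ∀ i, (q i : ℝ) < x i ∧ x i < r i}.Nonempty ∧
      {x : Fin n → ℝ | ∀ i, (q i : ℝ) < x i ∧ x i < r i} ⊆ U := by
  obtain ⟨x, hx⟩ := hU
  obtain ⟨ε, hε, hb⟩ := Metric.mem_nhds_iff.1 (mem_interior_iff_mem_nhds.1 hx)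
  choose q hq using fun i => exists_rat_btwn (show x i - ε < x i by linarith)
  choose r hr using fun i => exists_rat_btwn (show x i < x i + ε by linarith)
  refine ⟨q, r, ⟨x, fun i => ⟨(hq i).2, (hr i).1⟩⟩, fun y hy => hb ?_⟩
  rw [Metric.mem_ball, dist_pi_lt_iff hε]
  intro i
  rw [Real.dist_eq, abs_lt]
  have := hy i
  have := hq i
  have := hr i
  constructor <;> linarith

theorem def_box (hK : Good K) {n : ℕ} (A : Set ℝ) (q r : Fin n → ℚ) :
    A.Definable K {x : Fin n → ℝ | ∀ i, (q i : ℝ) < x i ∧ x i < r i} := by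
  have h := definable_iInter_of_finite (A := A) (L := K) (f := fun i : Fin n =>
    {x : Fin n → ℝ | (q i : ℝ) < x i ∧ x i < r i}) (fun i =>
      (((hK.rgt (q i)).mono (Set.empty_subset A)).preimage_comp (fun _ : Fin 1 => i)).inter
      (((hK.rlt (r i)).mono (Set.empty_subset A)).preimage_comp (fun _ : Fin 1 => i)))
  convert h using 1
  ext x; simp

theorem isOpen_box {n : ℕ} (q r : Fin n → ℚ) :
    IsOpen {x : Fin n → ℝ | ∀ i, (q i : ℝ) < x i ∧ x i < r i} := by
  have : {x : Fin n → ℝ | ∀ i, (q i : ℝ) < x i ∧ x i < r i}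
      = ⋂ i, {x : Fin n → ℝ | (q i : ℝ) < x i ∧ x i < r i} := by ext x; simp
  rw [this]
  exact isOpen_iInter_of_finite fun i =>
    (isOpen_lt continuous_const (continuous_apply i)).inter
      (isOpen_lt (continuous_apply i) continuous_const)

theorem indep_interior (hK : Good K) : ∀ (n : ℕ) (A : Set ℝ) (Z : Set (Fin n → ℝ)),
    A.Definable K Z → ∀ z ∈ Z, rk K A (List.ofFn z) = n → (interior Z).Nonempty := by
  intro n
  induction n with
  | zero =>
    intro A Z _ z hz _
    have : Z = Set.univ := by
      ext w; simp [Subsingleton.elim w z, hz]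
    rw [this, interior_univ]; exact ⟨z, trivial⟩
  | succ n ih =>
    intro A Z hZ z hz hr
    rw [List.ofFn_succ, rk] at hr
    have hle := rk_le (K := K) (List.ofFn fun i : Fin n => z i.succ) (insert (z 0) A)
    rw [List.length_ofFn] at hle
    have hz0 : z 0 ∉ cl K A := by
      intro h; simp [h] at hr; omega
    have hr' : rk K (insert (z 0) A) (List.ofFn fun i : Fin n => z i.succ) = n := by
      simp [hz0] at hr; omega
    have hZ' := hZ.preimage_comp (Fin.cons (Sum.inl 0) Sum.inr : Fin (n+1) → Fin 1 ⊕ Fin n)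
    have ec : ∀ (t : Fin 1 → ℝ) (x : Fin n → ℝ),
        Sum.elim t x ∘ (Fin.cons (Sum.inl 0) Sum.inr : Fin (n+1) → Fin 1 ⊕ Fin n)
          = Fin.cons (t 0) x := by
      intro t x; ext i
      refine Fin.cases ?_ (fun i => ?_) i <;> simp
    have hI := ih _ _ (def_section1 hZ' (z 0)) (fun i => z i.succ) (by
      rw [Set.mem_ofPred_eq, Set.mem_preimage, ec]
      convert hz using 1
      exact Fin.cons_self_tail z) hr'
    obtain ⟨q, r, hne, hsub⟩ := exists_rat_box hI
    have hW := (((def_box hK A q r).preimage_comp (Sum.inl : Fin n → Fin n ⊕ Fin 1)).himp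
      (hZ'.preimage_comp (Sum.swap : Fin 1 ⊕ Fin n → Fin n ⊕ Fin 1))).preimage_comp
      (Sum.swap : Fin n ⊕ Fin 1 → Fin 1 ⊕ Fin n) |>.forall_of_finite
    let W : Set ℝ := {t | ∀ x : Fin n → ℝ, (∀ i, (q i : ℝ) < x i ∧ x i < r i) →
      (Fin.cons t x : Fin (n+1) → ℝ) ∈ Z}
    have hWd : A.Definable₁ K W := by
      unfold Definable₁
      convert hW using 1
      ext t
      simp only [W, Set.mem_ofPred_eq, Set.mem_preimage, himp_eq, Set.sup_eq_union,
        Set.mem_union, Set.mem_compl_iff]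
      refine forall_congr' fun x => ?_
      rw [← ec t x]
      have e1 : (Sum.elim t x ∘ Sum.swap) ∘ Sum.inl = x := by ext i; simp
      have e2 : (Sum.elim t x ∘ Sum.swap) ∘ Sum.swap = Sum.elim t x := by
        ext (i | i) <;> simp
      rw [e1, e2]
      tauto
    have hW0 : z 0 ∈ W := by
      intro x hx
      have := hsub hx
      rw [Set.mem_ofPred_eq, Set.mem_preimage, ec] at this
      exact this
    have hWi : (interior W).Nonempty := by
      refine (hK.dich W (hWd.mono (Set.subset_univ _))).resolve_left fun h => ?_
      exact hz0 ⟨W, hWd, h, hW0⟩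
    obtain ⟨t, ht⟩ := hWi
    obtain ⟨x, hx⟩ := hne
    refine ⟨(Fin.cons t x : Fin (n+1) → ℝ), ?_⟩
    refine mem_interior.2 ⟨{v | v 0 ∈ interior W} ∩
      (fun v : Fin (n+1) → ℝ => fun i : Fin n => v i.succ) ⁻¹'
        {x : Fin n → ℝ | ∀ i, (q i : ℝ) < x i ∧ x i < r i}, ?_, ?_, ?_⟩
    · rintro v ⟨hv0, hv1⟩
      have := interior_subset hv0 _ hv1
      convert this using 1
      exact (Fin.cons_self_tail v).symm
    · exact (isOpen_interior.preimage (continuous_apply 0)).inter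
        ((isOpen_box q r).preimage (by fun_prop))
    · exact ⟨by simpa using ht, by simpa using hx⟩

theorem exists_generic (hK : Good K) : ∀ (n : ℕ) (A : Set ℝ), A.Countable →
    ∀ (U : Set (Fin n → ℝ)), IsOpen U → U.Nonempty → ∃ z ∈ U, rk K A (List.ofFn z) = n := by
  intro n
  induction n with
  | zero =>
    rintro A _ U _ ⟨z, hz⟩
    exact ⟨z, hz, by simp [rk]⟩
  | succ n ih =>
    rintro A hA U hU ⟨u, hu⟩
    have h1 : IsOpen {t : ℝ | (Fin.cons t (fun i => u i.succ) : Fin (n+1) → ℝ) ∈ U} :=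
      hU.preimage (by
        refine continuous_pi fun i => ?_
        refine Fin.cases ?_ (fun i => ?_) i
        · simpa using continuous_id'
        · simpa using continuous_const)
    have h2 : u 0 ∈ {t : ℝ | (Fin.cons t (fun i => u i.succ) : Fin (n+1) → ℝ) ∈ U} := by
      rw [Set.mem_ofPred_eq]
      convert hu using 1
      exact Fin.cons_self_tail u
    obtain ⟨t, ht, htc⟩ := ((cl_countable hK hA).dense_compl ℝ).inter_open_nonempty _ h1 ⟨_, h2⟩
    have h3 : IsOpen {x : Fin n → ℝ | (Fin.cons t x : Fin (n+1) → ℝ) ∈ U} :=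
      hU.preimage (by
        refine continuous_pi fun i => ?_
        refine Fin.cases ?_ (fun i => ?_) i
        · simpa using continuous_const
        · simpa using continuous_apply i)
    obtain ⟨x, hx, hr⟩ := ih (insert t A) (hA.insert t) _ h3 ⟨_, ht⟩
    refine ⟨_, hx, ?_⟩
    rw [List.ofFn_succ, rk]
    have : t ∉ cl K A := htc
    simp [hr, this, add_comm]

theorem hasDimGE_of_rk (hK : Good K) {n : ℕ} {A : Set ℝ} {Z : Set (Fin n → ℝ)}
    (hZ : A.Definable K Z) {z : Fin n → ℝ} (hz : z ∈ Z) :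
    hasDimGE Z (rk K A (List.ofFn z)) := by
  obtain ⟨l, h1, h2, h3⟩ := exists_indep hK (List.ofFn z) A
  rw [List.ofFn_eq_map] at h1
  obtain ⟨l'', h4, rfl⟩ := List.sublist_map_iff.1 h1
  have hs : StrictMono l''.get :=
    (List.Pairwise.sublist h4 (List.sortedLT_finRange n).pairwise).sortedLT.strictMono_get
  have hlen : l''.length = rk K A (List.ofFn z) := by rw [← h3, List.length_map]
  rw [← hlen]
  refine ⟨l''.get, hs, ?_⟩
  refine indep_interior hK _ A _ (hZ.image_comp l''.get) (z ∘ l''.get) ⟨z, hz, rfl⟩ ?_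
  have : List.ofFn (z ∘ l''.get) = l''.map z := by
    apply List.ext_get <;> simp
  rw [this, h2, List.length_map]

theorem rk_of_hasDimGE (hK : Good K) {n d : ℕ} {A : Set ℝ} (hA : A.Countable)
    {Z : Set (Fin n → ℝ)} (h : hasDimGE Z d) : ∃ z ∈ Z, d ≤ rk K A (List.ofFn z) := by
  obtain ⟨ι, hι, hne⟩ := h
  obtain ⟨w, hw, hr⟩ := exists_generic hK d A hA _ isOpen_interior hne
  obtain ⟨z, hz, rfl⟩ := interior_subset hw
  refine ⟨z, hz, ?_⟩
  rw [← hr]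
  apply rk_subperm hK
  have h1 : (List.ofFn ι).Subperm (List.finRange n) :=
    List.subperm_of_subset (List.nodup_ofFn.2 hι.injective) (fun i _ => List.mem_finRange i)
  have h2 : ((List.ofFn ι).map z).Subperm ((List.finRange n).map z) := by
    obtain ⟨l₁, h, h'⟩ := h1
    exact ⟨l₁.map z, h.map z, h'.map z⟩
  rw [← List.ofFn_eq_map] at h2
  convert h2 using 1
  rw [List.map_ofFn]; rfl

theorem dim_char (hK : Good K) {n : ℕ} {A : Set ℝ} (hA : A.Countable) {Z : Set (Fin n → ℝ)}
    (hZ : A.Definable K Z) (hne : Z.Nonempty) :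
    ∃ k : ℕ, dimDef Z = (k : WithBot ℕ) ∧ (∃ z ∈ Z, rk K A (List.ofFn z) = k) ∧
      ∀ z ∈ Z, rk K A (List.ofFn z) ≤ k := by
  have hb : BddAbove ((fun z => rk K A (List.ofFn z)) '' Z) := by
    refine ⟨n, ?_⟩
    rintro _ ⟨z, _, rfl⟩
    simpa using rk_le (K := K) (List.ofFn z) A
  have hmem := Nat.sSup_mem (hne.image _) hb
  set k := sSup ((fun z => rk K A (List.ofFn z)) '' Z)
  have hle : ∀ z ∈ Z, rk K A (List.ofFn z) ≤ k := fun z hz => le_csSup hb ⟨z, hz, rfl⟩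
  obtain ⟨z, hz, hzk⟩ := hmem
  refine ⟨k, ?_, ⟨z, hz, hzk⟩, hle⟩
  rw [dimDef, if_pos hne]
  congr 1
  refine IsGreatest.csSup_eq ⟨?_, ?_⟩
  · have := hasDimGE_of_rk hK hZ hz
    dsimp only at hzk
    rwa [hzk] at this
  · intro d hd
    obtain ⟨w, hw, hdw⟩ := rk_of_hasDimGE hK hA hd
    exact hdw.trans (hle w hw)

theorem main_good (hK : Good K) (m m' e : ℕ) (X : Set (Fin m → ℝ)) (Y : Set (Fin m' → ℝ))
    (f : (Fin m → ℝ) → (Fin m' → ℝ))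
    (hfdef : (∅ : Set ℝ).Definable K {z : (Fin m ⊕ Fin m') → ℝ |
    (fun i => z (Sum.inl i)) ∈ X ∧ (fun j => z (Sum.inr j)) = f (fun i => z (Sum.inl i))})
    (hmaps : Set.MapsTo f X Y) (hsurj : Set.SurjOn f X Y)
    (hfib : ∀ y ∈ Y, dimDef {x ∈ X | f x = y} = (e : WithBot ℕ)) :
    dimDef X = dimDef Y + (e : WithBot ℕ) := by
  set Γ := {z : (Fin m ⊕ Fin m') → ℝ |
    (fun i => z (Sum.inl i)) ∈ X ∧ (fun j => z (Sum.inr j)) = f (fun i => z (Sum.inl i))} with hΓ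
  have hX : (∅ : Set ℝ).Definable K X := by
    convert hfdef.image_comp (Sum.inl : Fin m → Fin m ⊕ Fin m') using 1
    ext x
    constructor
    · intro hx
      exact ⟨Sum.elim x (f x), ⟨by simpa using hx, by simp⟩, by ext i; simp⟩
    · rintro ⟨z, hz, rfl⟩
      exact hz.1
  have hY : (∅ : Set ℝ).Definable K Y := by
    convert hfdef.image_comp (Sum.inr : Fin m' → Fin m ⊕ Fin m') using 1
    ext y
    constructor
    · intro hy
      obtain ⟨x, hx, rfl⟩ := hsurj hy
      exact ⟨Sum.elim x (f x), ⟨by simpa using hx, by simp⟩, by ext i; simp⟩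
    · rintro ⟨z, hz, rfl⟩
      have : z ∘ Sum.inr = f (fun i => z (Sum.inl i)) := hz.2
      dsimp only
      rw [this]; exact hmaps hz.1
  have hF : ∀ y : Fin m' → ℝ, (Set.range y).Definable K {x ∈ X | f x = y} := by
    intro y
    have h1 := hfdef.preimage_comp (Sum.swap : Fin m ⊕ Fin m' → Fin m' ⊕ Fin m)
    have := def_section h1 y
    rw [Set.empty_union] at this
    convert this using 1
    ext x
    simp [hΓ, eq_comm]
  have hgr : ∀ x ∈ X, ∀ t ∈ List.ofFn (f x), t ∈ cl K ({t | t ∈ List.ofFn x}) := by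
    intro x hx t ht
    obtain ⟨j, rfl⟩ := (List.mem_ofFn' _ _).1 ht
    refine ⟨{f x j}, ?_, Set.countable_singleton _, rfl⟩
    have h1 := (def_section hfdef x).image_comp (fun _ : Fin 1 => j)
    rw [Set.empty_union] at h1
    have h2 : Set.range x ⊆ {t | t ∈ List.ofFn x} := by
      rintro _ ⟨i, rfl⟩
      simp
    unfold Definable₁
    convert h1.mono h2 using 1
    ext v
    simp only [hΓ, Set.mem_ofPred_eq, Set.mem_image, Sum.elim_inl, Sum.elim_inr,
      Set.mem_singleton_iff]
    constructor
    · intro h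
      exact ⟨f x, ⟨hx, rfl⟩, by ext i; rw [Subsingleton.elim i 0, h]; rfl⟩
    · rintro ⟨w, ⟨_, h⟩, rfl⟩
      exact congrFun h j
  have hadd : ∀ x ∈ X, rk K ∅ (List.ofFn x)
      = rk K ∅ (List.ofFn (f x)) + rk K (Set.range (f x)) (List.ofFn x) := by
    intro x hx
    have h1 := rk_append (K := K) (List.ofFn x) (List.ofFn (f x)) ∅
    have h2 := rk_append (K := K) (List.ofFn (f x)) (List.ofFn x) ∅
    rw [Set.empty_union] at h1 h2
    rw [rk_zero hK _ (hgr x hx), add_zero] at h1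
    rw [← h1, rk_perm hK List.perm_append_comm, h2]
    congr 2
    ext t; simp [List.mem_ofFn']
  rcases Y.eq_empty_or_nonempty with rfl | hYne
  · have : X = ∅ := by
      rw [Set.eq_empty_iff_forall_notMem]; exact fun x hx => hmaps hx
    simp [dimDef, this]
  obtain ⟨y0, hy0⟩ := hYne
  have hfibne : ∀ y ∈ Y, {x ∈ X | f x = y}.Nonempty := by
    intro y hy
    obtain ⟨x, hx, rfl⟩ := hsurj hy
    exact ⟨x, hx, rfl⟩
  obtain ⟨x0, hx0, -⟩ := hsurj hy0
  obtain ⟨a, ha, ⟨x1, hx1, hx1a⟩, haX⟩ := dim_char hK Set.countable_empty hX ⟨x0, hx0⟩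
  obtain ⟨b, hb, ⟨y1, hy1, hy1b⟩, hbY⟩ := dim_char hK Set.countable_empty hY ⟨y0, hy0⟩
  have hfc : ∀ y ∈ Y, (∃ x ∈ X, f x = y ∧ rk K (Set.range y) (List.ofFn x) = e) ∧
      ∀ x ∈ X, f x = y → rk K (Set.range y) (List.ofFn x) ≤ e := by
    intro y hy
    obtain ⟨c, hc, ⟨x, hx, hxc⟩, hcX⟩ :=
      dim_char hK (Set.countable_range y) (hF y) (hfibne y hy)
    have : c = e := by
      rw [hfib y hy] at hc; exact_mod_cast hc.symm
    subst this
    exact ⟨⟨x, hx.1, hx.2, hxc⟩, fun x hx hxy => hcX x ⟨hx, hxy⟩⟩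
  have hab : a = b + e := by
    apply le_antisymm
    · rw [← hx1a, hadd x1 hx1]
      exact add_le_add (hbY _ (hmaps hx1)) ((hfc _ (hmaps hx1)).2 x1 hx1 rfl)
    · obtain ⟨x, hx, hxy, hxe⟩ := (hfc y1 hy1).1
      have := hadd x hx
      rw [hxy, hy1b, hxe] at this
      rw [← this]; exact haX x hx
  rw [ha, hb, hab]
  push_cast
  rfl

/-- The relational language whose symbols are the members of a family of sets. -/
def famLang (C : Set (Σ n, Set (Fin n → ℝ))) : FirstOrder.Language where
  Functions := fun _ => Empty
  Relations := fun n => {s : Set (Fin n → ℝ) // (⟨n, s⟩ : Σ n, Set (Fin n → ℝ)) ∈ C}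

instance famStr (C : Set (Σ n, Set (Fin n → ℝ))) : (famLang C).Structure ℝ where
  funMap := fun g => Empty.elim g
  RelMap := fun r x => x ∈ r.1

theorem famLang_countable {C : Set (Σ n, Set (Fin n → ℝ))} (hC : C.Countable) :
    Countable (famLang C).Symbols := by
  have : Countable C := hC
  have h1 : Countable (Σ l, (famLang C).Functions l) :=
    Function.Injective.countable (β := ℕ) (f := fun x => Empty.elim x.2) fun x => Empty.elim x.2
  have h2 : Countable (Σ l, (famLang C).Relations l) := by
    refine Function.Injective.countable (β := C) (f := fun x => ⟨⟨x.1, x.2.1⟩, x.2.2⟩) ?_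
    rintro ⟨n, s, hs⟩ ⟨n', s', hs'⟩ h
    simp only [Subtype.mk.injEq, Sigma.mk.injEq] at h
    obtain ⟨rfl, h⟩ := h
    cases h
    rfl
  unfold FirstOrder.Language.Symbols
  infer_instance

theorem famLang_def {C : Set (Σ n, Set (Fin n → ℝ))} {n : ℕ} {s : Set (Fin n → ℝ)}
    (h : (⟨n, s⟩ : Σ n, Set (Fin n → ℝ)) ∈ C) : (∅ : Set ℝ).Definable (famLang C) s := by
  rw [empty_definable_iff]
  refine ⟨FirstOrder.Language.Relations.formula (L := famLang C) (n := n) ⟨s, h⟩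
    (fun i => Language.Term.var i), ?_⟩
  ext x
  simp only [Set.mem_ofPred_eq]
  rfl

theorem transfer_term (L : FirstOrder.Language) [L.Structure ℝ]
    {C : Set (Σ n, Set (Fin n → ℝ))} {α : Type} (t : (famLang C)[[(Set.univ : Set ℝ)]].Term α) :
    ∃ t' : L[[(Set.univ : Set ℝ)]].Term α, ∀ v : α → ℝ, t.realize v = t'.realize v := by
  induction t with
  | var i => exact ⟨Language.Term.var i, fun v => rfl⟩
  | @func l g ts _ =>
    rcases g with g | g
    · exact Empty.elim g
    · cases l with
      | zero =>
        refine ⟨Language.Term.func (Sum.inr g) (fun i => i.elim0), fun v => ?_⟩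
        rfl
      | succ l => exact PEmpty.elim g

theorem transfer (L : FirstOrder.Language) [L.Structure ℝ]
    {C : Set (Σ n, Set (Fin n → ℝ))} (hC : ∀ c ∈ C, IsDef L c.2) {α : Type} {n : ℕ}
    (φ : (famLang C)[[(Set.univ : Set ℝ)]].BoundedFormula α n) :
    ∃ ψ : L[[(Set.univ : Set ℝ)]].BoundedFormula α n, ∀ (v : α → ℝ) (xs : Fin n → ℝ),
      φ.Realize v xs ↔ ψ.Realize v xs := by
  induction φ with
  | falsum => exact ⟨⊥, fun v xs => Iff.rfl⟩
  | equal t₁ t₂ =>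
    obtain ⟨t₁', h₁⟩ := transfer_term L t₁
    obtain ⟨t₂', h₂⟩ := transfer_term L t₂
    refine ⟨t₁'.bdEqual t₂', fun v xs => ?_⟩
    rw [Language.BoundedFormula.realize_bdEqual, ← h₁, ← h₂]
    rfl
  | @rel n l R ts =>
    rcases R with R | R
    · choose ts' hts using fun i => transfer_term L (ts i)
      obtain ⟨θ, hθ⟩ := hC _ R.2
      refine ⟨Language.BoundedFormula.relabel (n := n) (k := 0) id
        (Language.BoundedFormula.subst θ ts'), fun v xs => ?_⟩
      rw [Language.BoundedFormula.realize_relabel, Language.BoundedFormula.realize_subst,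
        Language.Formula.boundedFormula_realize_eq_realize]
      have h1 : ∀ x : Fin l → ℝ, x ∈ R.1 ↔ θ.Realize x := fun x => by
        have := congrArg (fun s => x ∈ s) hθ
        simpa using this
      have h2 : (Language.BoundedFormula.rel (L := (famLang C)[[(Set.univ : Set ℝ)]])
          (Sum.inl R : ((famLang C)[[(Set.univ : Set ℝ)]]).Relations l) ts).Realize v xs ↔
          (fun i => (ts i).realize (Sum.elim v xs)) ∈ R.1 := Iff.rfl
      rw [h2, h1]
      simp only [hts]
      rfl
    · exact isEmptyElim R
  | imp _ _ ih₁ ih₂ =>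
    obtain ⟨ψ₁, h₁⟩ := ih₁
    obtain ⟨ψ₂, h₂⟩ := ih₂
    exact ⟨ψ₁.imp ψ₂, fun v xs => by
      rw [Language.BoundedFormula.realize_imp, Language.BoundedFormula.realize_imp, h₁, h₂]⟩
  | all _ ih =>
    obtain ⟨ψ, h⟩ := ih
    exact ⟨ψ.all, fun v xs => by
      rw [Language.BoundedFormula.realize_all, Language.BoundedFormula.realize_all]
      simp only [h]⟩

theorem discrete_countable {D : Set ℝ} (h : IsDiscreteSet D) : D.Countable := by
  have : DiscreteTopology D := by
    rw [discreteTopology_subtype_iff']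
    exact h
  exact Set.countable_coe_iff.1 (TopologicalSpace.separableSpace_iff_countable.1 inferInstance)

theorem dmin_dich {L : FirstOrder.Language} [L.Structure ℝ] (hL : DMinimal L) (S : Set ℝ)
    (hS : (Set.univ : Set ℝ).Definable₁ L S) : S.Countable ∨ (interior S).Nonempty := by
  have h : IsDef L {x : Fin 0 ⊕ Unit → ℝ | x (Sum.inr ()) ∈ S} :=
    Definable.preimage_comp (fun _ : Fin 1 => (Sum.inr () : Fin 0 ⊕ Unit)) hS
  obtain ⟨N, hN⟩ := hL.2 0 _ h
  obtain ⟨U, D, hU, hD, he⟩ := hN (fun i => i.elim0)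
  simp only [Set.mem_ofPred_eq, Sum.elim_inr] at he
  have he : S = U ∪ ⋃ i, D i := he
  rcases U.eq_empty_or_nonempty with rfl | hne
  · left
    rw [he, Set.empty_union]
    exact Set.countable_iUnion fun i => discrete_countable (hD i)
  · right
    refine hne.mono (interior_maximal ?_ hU)
    rw [he]; exact Set.subset_union_left

/-- the countable family used -/
def theFam (N : ℕ) (G : Set (Fin N → ℝ)) : Set (Σ n, Set (Fin n → ℝ)) :=
  {⟨2, {x | x 0 < x 1}⟩, ⟨N, G⟩} ∪ Set.range (fun q : ℚ => ⟨1, {x | x 0 ∈ Set.Iio (q : ℝ)}⟩) ∪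
    Set.range (fun q : ℚ => ⟨1, {x | x 0 ∈ Set.Ioi (q : ℝ)}⟩)

theorem good_fam {L : FirstOrder.Language} [L.Structure ℝ] (hL : DMinimal L) {N : ℕ}
    {G : Set (Fin N → ℝ)} (hG : IsDef L G) : Good (famLang (theFam N G)) := by
  have hlt : ∀ f g : (Fin 1 → ℝ) → ℝ, (Set.univ : Set ℝ).DefinableFun L f →
      (Set.univ : Set ℝ).DefinableFun L g → IsDef L {x | f x < g x} := by
    intro f g hf hg
    refine Set.Definable.preimage_map (F := fun x => ![f x, g x]) ?_ hL.1.1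
    intro i
    fin_cases i
    · exact hf
    · exact hg
  have hC : ∀ c ∈ theFam N G, IsDef L c.2 := by
    rintro c (((rfl | rfl) | ⟨q, rfl⟩) | ⟨q, rfl⟩)
    · exact hL.1.1
    · exact hG
    · exact hlt (fun x => x 0) (fun _ => q) (L.definableFun_var 0).of_empty
        (L.definableFun_const _ trivial)
    · exact hlt (fun _ => q) (fun x => x 0)
        (L.definableFun_const _ trivial) (L.definableFun_var 0).of_empty
  refine ⟨famLang_countable ?_, ?_, ?_, ?_, ?_⟩
  · exact ((Set.toFinite _).countable.union (Set.countable_range _)).union (Set.countable_range _)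
  · rintro S ⟨φ, hφ⟩
    obtain ⟨ψ, hψ⟩ := transfer L hC φ
    refine dmin_dich hL S ⟨ψ, ?_⟩
    rw [hφ]
    ext v
    exact hψ v _
  · exact famLang_def (Or.inl (Or.inl (Or.inl rfl)))
  · exact fun q => famLang_def (Or.inl (Or.inr ⟨q, rfl⟩))
  · exact fun q => famLang_def (Or.inr ⟨q, rfl⟩)

end helpers

/-- fiber-dimension formula for definable maps. -/
theorem stmt17 (L : FirstOrder.Language) [L.Structure ℝ] (hL : DMinimal L)
    (m m' e : ℕ) (X : Set (Fin m → ℝ)) (Y : Set (Fin m' → ℝ))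
    (hX : IsDef L X) (hY : IsDef L Y)
    (f : (Fin m → ℝ) → (Fin m' → ℝ)) (hfdef : IsDefMapOn L X f)
    (hmaps : Set.MapsTo f X Y) (hsurj : Set.SurjOn f X Y)
    (hfib : ∀ y ∈ Y, dimDef {x ∈ X | f x = y} = (e : WithBot ℕ)) :
    dimDef X = dimDef Y + (e : WithBot ℕ) := by
  obtain ⟨G, hGe⟩ : ∃ G : Set (Fin (m + m') → ℝ), G =
    ((fun g : Fin (m + m') → ℝ => g ∘ (finSumFinEquiv : Fin m ⊕ Fin m' → Fin (m + m'))) ⁻¹'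
      {z : (Fin m ⊕ Fin m') → ℝ |
        (fun i => z (Sum.inl i)) ∈ X ∧ (fun j => z (Sum.inr j)) = f (fun i => z (Sum.inl i))}) :=
    ⟨_, rfl⟩
  have hG : IsDef L G := by
    rw [hGe]
    exact Definable.preimage_comp (finSumFinEquiv : Fin m ⊕ Fin m' → Fin (m + m')) hfdef
  refine main_good (good_fam hL hG) m m' e X Y f ?_ hmaps hsurj hfib
  have h := (famLang_def (C := theFam _ G) (Or.inl (Or.inl (Or.inr rfl)))).preimage_comp
    (finSumFinEquiv (m := m) (n := m')).symm
  convert h using 1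
  ext z
  simp [hGe, -finSumFinEquiv_apply_left, -finSumFinEquiv_apply_right]

end DMinPaper
end
end
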